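/- arXiv:2409.04870 — 3 statements merged into one kernel-verified Lean document; each statement's English description precedes it below -/
import Mathlib

section
/- There exists a constant C > 0 such that for all real t ≥ 1, |J₀(t) − (cos t + sin t)/√(π t)| ≤ C t^{−3/2}. -/
open Complex Real MeasureTheory

/-- The Bessel function of the first kind of integer order `n`, via the
integral representation `J_n(t) = (1/(2π)) ∫_{−π}^{π} exp(i(t sin φ − n φ)) dφ`. -/
noncomputable def besselJ (n : ℤ) (t : ℝ) : ℂ :=
  (1 / (2 * Real.pi)) *
    ∫ φ in (-Real.pi)..Real.pi,
      Complex.exp (Complex.I * ((t : ℂ) * (Real.sin φ : ℂ) - (n : ℂ) * (φ : ℂ)))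


lemma fres_antideriv (b : ℂ) (hb : b ≠ 0) (u : ℝ) (hu : 0 < u) :
    HasDerivAt (fun u : ℝ => -(cexp (-b * (u:ℂ)^2) / (2 * b * u)) +
        cexp (-b * (u:ℂ)^2) / (4 * b^2 * (u:ℂ)^3))
      (cexp (-b * (u:ℂ)^2) - cexp (-b * (u:ℂ)^2) * (3 / (4 * b^2 * (u:ℂ)^4))) u := by
  have hu' : (u:ℂ) ≠ 0 := by exact_mod_cast hu.ne'
  have h0 : HasDerivAt (fun u : ℝ => (u:ℂ)) 1 u := by
    simpa using (hasDerivAt_id u).ofReal_comp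
  have hE : HasDerivAt (fun u : ℝ => cexp (-b * (u:ℂ)^2))
      (cexp (-b * (u:ℂ)^2) * (-b * (2 * u))) u := by
    have := ((h0.pow 2).const_mul (-b)).cexp
    simpa using this
  have h1 := hE.div (h0.const_mul (2 * b)) (by simp [hb, hu'])
  have h2 := hE.div ((h0.pow 3).const_mul (4 * b^2)) (by simp [hb, hu'])
  refine (h1.neg.add h2).congr_deriv ?_
  simp only [Pi.pow_apply]
  field_simp
  ring

lemma norm_cexp_neg (b : ℂ) (hb : 0 ≤ b.re) (u : ℝ) : ‖cexp (-b * (u:ℂ)^2)‖ ≤ 1 := by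
  rw [Complex.norm_exp]
  have : (-b * (u:ℂ)^2).re = -(b.re * u^2) := by
    rw [← Complex.ofReal_pow, Complex.re_mul_ofReal]; simp
  rw [this]
  apply Real.exp_le_one_iff.2
  have := mul_nonneg hb (sq_nonneg u)
  linarith

lemma tail_eps (b : ℂ) (hb : 0 < b.re) (x : ℝ) (hx : 0 < x) :
    ‖(∫ u in Set.Ioi x, cexp (-b * (u:ℂ)^2)) - cexp (-b * (x:ℂ)^2) / (2 * b * x)‖ ≤
      1 / (2 * ‖b‖^2 * x^3) := by
  have hb0 : b ≠ 0 := by rintro rfl; simp at hb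
  have hbn : 0 < ‖b‖ := norm_pos_iff.2 hb0
  have hi1 : IntegrableOn (fun u : ℝ => cexp (-b * (u:ℂ)^2)) (Set.Ioi x) :=
    (integrable_cexp_neg_mul_sq hb).integrableOn
  have hpow : IntegrableOn (fun u : ℝ => 3 / (4 * ‖b‖^2) * u ^ (-4:ℝ)) (Set.Ioi x) :=
    (integrableOn_Ioi_rpow_of_lt (by norm_num) hx).const_mul _
  have hbd : ∀ u ∈ Set.Ioi x, ‖cexp (-b * (u:ℂ)^2) * (3 / (4 * b^2 * (u:ℂ)^4))‖ ≤
      3 / (4 * ‖b‖^2) * u ^ (-4:ℝ) := by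
    intro u hu
    have hu0 : 0 < u := hx.trans hu
    have e : u ^ (-4:ℝ) = (u^4)⁻¹ := by
      rw [Real.rpow_neg hu0.le]; norm_cast
    rw [norm_mul, e]
    have := norm_cexp_neg b hb.le u
    calc _ ≤ 1 * ‖(3 / (4 * b^2 * (u:ℂ)^4))‖ := by gcongr
      _ = _ := by
        simp [abs_of_pos hu0]; field_simp
  have hi2 : IntegrableOn (fun u : ℝ => cexp (-b * (u:ℂ)^2) * (3 / (4 * b^2 * (u:ℂ)^4)))
      (Set.Ioi x) := by
    refine Integrable.mono' hpow ?_ ((ae_restrict_mem measurableSet_Ioi).mono hbd)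
    exact (by fun_prop : Measurable _).aestronglyMeasurable
  have hlim : Filter.Tendsto (fun u : ℝ => -(cexp (-b * (u:ℂ)^2) / (2 * b * u)) +
        cexp (-b * (u:ℂ)^2) / (4 * b^2 * (u:ℂ)^3)) Filter.atTop (nhds 0) := by
    refine squeeze_zero_norm' (a := fun u : ℝ => (1 / (2 * ‖b‖) + 1 / (4 * ‖b‖^2)) * u⁻¹) ?_ ?_
    · filter_upwards [Filter.eventually_ge_atTop (1:ℝ)] with u hu
      have hu0 : 0 < u := by linarith
      have := norm_cexp_neg b hb.le u
      calc _ ≤ ‖cexp (-b * (u:ℂ)^2) / (2 * b * u)‖ + ‖cexp (-b * (u:ℂ)^2) / (4 * b^2 * (u:ℂ)^3)‖ := by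
            refine (norm_add_le _ _).trans ?_
            rw [norm_neg]
        _ = ‖cexp (-b * (u:ℂ)^2)‖ / (2 * ‖b‖ * u) + ‖cexp (-b * (u:ℂ)^2)‖ / (4 * ‖b‖^2 * u^3) := by
            simp only [norm_div, norm_mul, norm_pow, Complex.norm_real, Real.norm_eq_abs, abs_of_pos hu0]
            norm_num
        _ ≤ 1 / (2 * ‖b‖ * u) + 1 / (4 * ‖b‖^2 * u) := by
            gcongr
            nlinarith [sq_nonneg u, mul_pos hu0 hu0, mul_nonneg hu0.le (by nlinarith : 0 ≤ u^2-1)]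
        _ = _ := by field_simp
    · have := (tendsto_inv_atTop_zero (𝕜 := ℝ)).const_mul (1 / (2 * ‖b‖) + 1 / (4 * ‖b‖^2))
      rwa [mul_zero] at this
  have key := integral_Ioi_of_hasDerivAt_of_tendsto'
    (fun u (hu : u ∈ Set.Ici x) => fres_antideriv b hb0 u (hx.trans_le hu)) (hi1.sub hi2) hlim
  rw [integral_sub hi1 hi2] at key
  have hn : ‖∫ u in Set.Ioi x, cexp (-b * (u:ℂ)^2) * (3 / (4 * b^2 * (u:ℂ)^4))‖ ≤
      1 / (4 * ‖b‖^2 * x^3) := by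
    refine (norm_integral_le_of_norm_le hpow ((ae_restrict_mem measurableSet_Ioi).mono hbd)).trans ?_
    rw [integral_const_mul, integral_Ioi_rpow_of_lt (by norm_num) hx]
    have e : x ^ (-4 + 1:ℝ) = (x^3)⁻¹ := by
      rw [show (-4+1:ℝ) = -3 by norm_num, Real.rpow_neg hx.le]; norm_cast
    rw [e]
    apply le_of_eq
    field_simp
    norm_num
  have hn2 : ‖cexp (-b * (x:ℂ)^2) / (4 * b^2 * (x:ℂ)^3)‖ ≤ 1 / (4 * ‖b‖^2 * x^3) := by
    have := norm_cexp_neg b hb.le x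
    simp only [norm_div, norm_mul, norm_pow, Complex.norm_real, Real.norm_eq_abs, abs_of_pos hx]
    rw [show ‖(4:ℂ)‖ = 4 by norm_num]
    gcongr
  have : (∫ u in Set.Ioi x, cexp (-b * (u:ℂ)^2)) - cexp (-b * (x:ℂ)^2) / (2 * b * x) =
     (∫ u in Set.Ioi x, cexp (-b * (u:ℂ)^2) * (3 / (4 * b^2 * (u:ℂ)^4)))
      - cexp (-b * (x:ℂ)^2) / (4 * b^2 * (x:ℂ)^3) := by
    linear_combination key
  rw [this]
  refine (norm_sub_le _ _).trans ((add_le_add hn hn2).trans (le_of_eq ?_))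
  field_simp
  norm_num

lemma gauss_eps (b : ℂ) (hb : 0 < b.re) (x : ℝ) (hx : 0 < x) :
    ‖(∫ u in (0:ℝ)..x, cexp (-b * (u:ℂ)^2)) - (π / b) ^ (1/2:ℂ) / 2
      + cexp (-b * (x:ℂ)^2) / (2 * b * x)‖ ≤ 1 / (2 * ‖b‖^2 * x^3) := by
  have h1 := integral_gaussian_complex_Ioi hb
  have hi : Integrable (fun u : ℝ => cexp (-b * (u:ℂ)^2)) := integrable_cexp_neg_mul_sq hb
  have h2 := intervalIntegral.integral_interval_add_Ioi (a := 0) (b := x) hi.integrableOn hi.integrableOn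
  have h3 := tail_eps b hb x hx
  rw [← norm_neg] at h3
  refine le_trans (le_of_eq ?_) h3
  congr 1
  rw [← h1, ← h2]; ring

lemma fres (t : ℝ) (ht : 0 < t) (x : ℝ) (hx : 0 < x) :
    ‖(∫ u in (0:ℝ)..x, cexp (-(I * t) * (u:ℂ)^2)) - (π / (I * t)) ^ (1/2:ℂ) / 2
      + cexp (-(I * t) * (x:ℂ)^2) / (2 * (I * t) * x)‖ ≤ 1 / (2 * t^2 * x^3) := by
  have hc1 : Continuous (fun b : ℂ => ∫ u in (0:ℝ)..x, cexp (-b * (u:ℂ)^2)) := by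
    apply intervalIntegral.continuous_parametric_intervalIntegral_of_continuous'
    fun_prop
  have ht0 : (t:ℂ) ≠ 0 := by exact_mod_cast ht.ne'
  have hx0 : (x:ℂ) ≠ 0 := by exact_mod_cast hx.ne'
  have hbe : ContinuousAt (fun e : ℝ => (e:ℂ) + I * t) 0 := by fun_prop
  have hc2 : ContinuousAt (fun e : ℝ => ‖(∫ u in (0:ℝ)..x, cexp (-((e:ℂ) + I * t) * (u:ℂ)^2)) - (π / ((e:ℂ) + I * t)) ^ (1/2:ℂ) / 2
      + cexp (-((e:ℂ) + I * t) * (x:ℂ)^2) / (2 * ((e:ℂ) + I * t) * x)‖) 0 := by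
    apply ContinuousAt.norm
    apply ContinuousAt.add
    · apply ContinuousAt.sub
      · exact hc1.continuousAt.comp hbe
      · apply ContinuousAt.div_const
        apply ContinuousAt.cpow
        · apply ContinuousAt.div continuousAt_const hbe; simp [ht.ne']
        · exact continuousAt_const
        · right
          simp [Complex.div_im, Complex.normSq, ht.ne', Real.pi_ne_zero]
    · apply ContinuousAt.div
      · fun_prop
      · fun_prop
      · simp [ht.ne', hx.ne']
  have hc3 : ContinuousAt (fun e : ℝ => 1 / (2 * ‖(e:ℂ) + I * t‖^2 * x^3)) 0 := by
    apply ContinuousAt.div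
    · fun_prop
    · fun_prop
    · simp [ht.ne', hx.ne']
  have := le_of_tendsto_of_tendsto (hc2.tendsto.mono_left nhdsWithin_le_nhds)
    (hc3.tendsto.mono_left (nhdsWithin_le_nhds (s := Set.Ioi 0))) (by
      filter_upwards [self_mem_nhdsWithin] with e he
      apply gauss_eps _ _ x hx
      simpa using he)
  simpa [abs_of_pos ht] using this

lemma sqrt_val (t : ℝ) (ht : 0 < t) : (π / (I * t)) ^ (1/2:ℂ) =
    ((√π / √t / √2 : ℝ) : ℂ) * (1 - I) := by
  have : (π / (I * t) : ℂ) = (((√π / √t / √2 : ℝ) : ℂ) * (1 - I))^2 := by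
    have h1 : ((√π:ℝ):ℂ)^2 = π := by exact_mod_cast Real.sq_sqrt Real.pi_pos.le
    have h2 : ((√t:ℝ):ℂ)^2 = t := by exact_mod_cast Real.sq_sqrt ht.le
    have h3 : ((√2:ℝ):ℂ)^2 = 2 := by exact_mod_cast Real.sq_sqrt (by norm_num : (0:ℝ) ≤ 2)
    have ht0 : (t:ℂ) ≠ 0 := by exact_mod_cast ht.ne'
    have e : (1 - I)^2 = -2 * I := by linear_combination Complex.I_sq
    push_cast
    rw [mul_pow, div_pow, div_pow, h1, h2, h3, e]
    field_simp
    simp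
  have hp : 0 < √π / √t / √2 := by positivity
  have harg : 0 < (((√π / √t / √2 : ℝ) : ℂ) * (1 - I)).re ∨
      (((√π / √t / √2 : ℝ) : ℂ) * (1 - I)) = 0 := by
    left
    rw [Complex.re_ofReal_mul]
    simpa using hp
  rw [this, show (1/2:ℂ) = ((2:ℕ):ℂ)⁻¹ by norm_num, Complex.pow_cpow_nat_inv (by norm_num)]
  · have := (abs_lt.1 (Complex.abs_arg_lt_pi_div_two_iff.2 harg)).1
    exact_mod_cast this
  · have := (abs_lt.1 (Complex.abs_arg_lt_pi_div_two_iff.2 harg)).2.le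
    exact_mod_cast this

lemma bessel_real (t : ℝ) : besselJ 0 t =
    ((2 / π * ∫ θ in (0:ℝ)..(π/2), Real.cos (t * Real.cos θ) : ℝ) : ℂ) := by
  have hc : ∀ a b, IntervalIntegrable (fun φ : ℝ => cexp (I * (t * (Real.sin φ : ℂ)))) volume a b :=
    fun a b => Continuous.intervalIntegrable (by fun_prop) a b
  have hr : ∀ a b, IntervalIntegrable (fun φ : ℝ => Real.cos (t * Real.sin φ)) volume a b :=
    fun a b => Continuous.intervalIntegrable (by fun_prop) a b
  have h1 : (∫ φ in (-π)..π, cexp (I * (t * (Real.sin φ : ℂ)))) =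
      ∫ φ in (0:ℝ)..π, (((2 * Real.cos (t * Real.sin φ) : ℝ)) : ℂ) := by
    rw [← intervalIntegral.integral_add_adjacent_intervals (hc (-π) 0) (hc 0 π)]
    have := intervalIntegral.integral_comp_neg (a := 0) (b := π)
      (fun φ : ℝ => cexp (I * (t * (Real.sin φ : ℂ))))
    rw [neg_zero] at this
    rw [← this, ← intervalIntegral.integral_add]
    · refine intervalIntegral.integral_congr fun φ _ => ?_
      simp only [Real.sin_neg]
      push_cast
      rw [Complex.two_cos]
      ring_nf
    · exact Continuous.intervalIntegrable (by fun_prop) _ _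
    · exact hc _ _
  have h2 : (∫ φ in (0:ℝ)..π, Real.cos (t * Real.sin φ)) =
      2 * ∫ φ in (0:ℝ)..(π/2), Real.cos (t * Real.sin φ) := by
    rw [← intervalIntegral.integral_add_adjacent_intervals (hr 0 (π/2)) (hr (π/2) π)]
    have := intervalIntegral.integral_comp_sub_left (a := 0) (b := π/2)
      (fun φ : ℝ => Real.cos (t * Real.sin φ)) π
    rw [sub_zero, sub_half] at this
    rw [← this]
    simp only [Real.sin_pi_sub]
    ring
  have h3 : (∫ φ in (0:ℝ)..(π/2), Real.cos (t * Real.sin φ)) =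
      ∫ θ in (0:ℝ)..(π/2), Real.cos (t * Real.cos θ) := by
    have := intervalIntegral.integral_comp_sub_left (a := 0) (b := π/2)
      (fun φ : ℝ => Real.cos (t * Real.sin φ)) (π/2)
    rw [sub_zero, sub_self] at this
    rw [← this]
    simp only [Real.sin_pi_div_two_sub]
  unfold besselJ
  simp only [Int.cast_zero, zero_mul, sub_zero]
  rw [h1, intervalIntegral.integral_ofReal, intervalIntegral.integral_const_mul, h2, h3]
  push_cast
  ring

noncomputable def gg (u : ℝ) : ℝ := 1 / √(1 - u^2/2)
noncomputable def ww (u : ℝ) : ℝ := u / (2 * √(1 - u^2/2) * (1 + √(1 - u^2/2)))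

lemma cpos {u : ℝ} (hu : u ∈ Set.Icc (0:ℝ) 1) : 0 < 1 - u^2/2 := by
  have := hu.1; have := hu.2; nlinarith

lemma gg_eq {u : ℝ} (hu : u ∈ Set.Icc (0:ℝ) 1) : gg u = 1 + u * ww u := by
  have h := cpos hu
  have hs := Real.sq_sqrt h.le
  have hp := Real.sqrt_pos.2 h
  unfold gg ww
  set c := √(1 - u^2/2)
  have : u^2 = 2 - 2 * c^2 := by linarith
  field_simp
  rw [this]; ring

lemma ww_contDiffAt {u : ℝ} (hu : u ∈ Set.Icc (0:ℝ) 1) : ContDiffAt ℝ 2 ww u := by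
  have h := cpos hu
  have hp := Real.sqrt_pos.2 h
  unfold ww
  have hs : ContDiffAt ℝ 2 (fun u : ℝ => √(1 - u^2/2)) u :=
    ContDiffAt.sqrt (by fun_prop) h.ne'
  apply ContDiffAt.div (by fun_prop)
  · fun_prop
  · positivity

lemma subst_int (t : ℝ) : (∫ θ in (0:ℝ)..(π/2), Real.cos (t * Real.cos θ)) =
    √2 * (cexp (I * t) * ∫ u in (0:ℝ)..1, cexp (-(I * t) * (u:ℂ)^2) * (gg u : ℂ)).re := by
  have hg : ContinuousOn gg (Set.Icc 0 1) := by
    unfold gg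
    apply ContinuousOn.div (by fun_prop) (by fun_prop)
    intro u hu
    exact (Real.sqrt_pos.2 (cpos hu)).ne'
  have him : (fun θ : ℝ => √2 * Real.sin (θ/2)) '' Set.uIcc 0 (π/2) ⊆ Set.Icc 0 1 := by
    rintro _ ⟨θ, hθ, rfl⟩
    rw [Set.uIcc_of_le (by positivity)] at hθ
    have h1 : 0 ≤ Real.sin (θ/2) := Real.sin_nonneg_of_nonneg_of_le_pi (by linarith [hθ.1])
        (by linarith [hθ.2, Real.pi_pos])
    refine ⟨by positivity, ?_⟩
    have h2 : Real.sin (θ/2) ≤ Real.sin (π/4) :=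
      Real.sin_le_sin_of_le_of_le_pi_div_two (by linarith [hθ.1, Real.pi_pos]) (by linarith [Real.pi_pos])
        (by linarith [hθ.2])
    rw [Real.sin_pi_div_four] at h2
    have := Real.sq_sqrt (show (0:ℝ) ≤ 2 by norm_num)
    show √2 * Real.sin (θ/2) ≤ 1
    nlinarith [Real.sqrt_nonneg 2]
  have hsub := intervalIntegral.integral_deriv_smul_comp'' (a := 0) (b := π/2)
    (f := fun θ : ℝ => √2 * Real.sin (θ/2)) (f' := fun θ : ℝ => √2/2 * Real.cos (θ/2))
    (g := fun u : ℝ => cexp (-(I * t) * (u:ℂ)^2) * (gg u : ℂ)) (by fun_prop)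
    (fun θ _ => by
      have h := (((hasDerivAt_id θ).div_const 2).sin.const_mul √2).hasDerivWithinAt (s := Set.Ioi θ)
      refine h.congr_deriv ?_
      simp; ring) (by fun_prop) (by
      apply ContinuousOn.mul (by fun_prop)
      exact Complex.continuous_ofReal.comp_continuousOn (hg.mono him))
  have e1 : √2 * Real.sin (π/2/2) = 1 := by
    rw [show π/2/2 = π/4 by ring, Real.sin_pi_div_four]
    have := Real.sq_sqrt (show (0:ℝ) ≤ 2 by norm_num)
    nlinarith
  simp only [zero_div, Real.sin_zero, mul_zero, e1] at hsub
  rw [← hsub, ← Complex.re_ofReal_mul, ← mul_assoc, ← intervalIntegral.integral_const_mul,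
    ← Complex.reCLM_apply,
    ← ContinuousLinearMap.intervalIntegral_comp_comm]
  · refine intervalIntegral.integral_congr fun θ hθ => ?_
    have hθ' := him ⟨θ, hθ, rfl⟩
    have hθ := hθ
    rw [Set.uIcc_of_le (by positivity)] at hθ
    have hcp : 0 < Real.cos (θ/2) := Real.cos_pos_of_mem_Ioo ⟨by linarith [hθ.1, Real.pi_pos], by linarith [hθ.2, Real.pi_pos]⟩
    have h2 := Real.sq_sqrt (show (0:ℝ) ≤ 2 by norm_num)
    have hg1 : gg (√2 * Real.sin (θ/2)) = 1 / Real.cos (θ/2) := by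
      unfold gg
      rw [mul_pow, h2, show 1 - 2 * Real.sin (θ/2)^2/2 = Real.cos (θ/2)^2 by
        rw [Real.cos_sq']; ring, Real.sqrt_sq hcp.le]
    have hcos : Real.cos θ = 1 - (√2 * Real.sin (θ/2))^2 := by
      rw [mul_pow, h2, Real.sin_sq]
      have := Real.cos_sq (θ/2)
      rw [show 2 * (θ/2) = θ by ring] at this
      rw [this]; ring
    simp only [Function.comp, Complex.reCLM_apply]
    rw [hg1, hcos]
    set s := √2 * Real.sin (θ/2)
    have : (√2:ℂ) * cexp (I * t) * ((√2/2 * Real.cos (θ/2)) • (cexp (-(I * t) * (s:ℂ)^2) * ((1 / Real.cos (θ/2) : ℝ) : ℂ)))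
      = cexp (((t * (1 - s^2) : ℝ) : ℂ) * I) := by
      have hcp' : (Real.cos (θ/2) : ℂ) ≠ 0 := by exact_mod_cast hcp.ne'
      have h2' : ((√2:ℝ):ℂ)^2 = 2 := by exact_mod_cast h2
      have : cexp (((t * (1 - s^2) : ℝ) : ℂ) * I) = cexp (I * t) * cexp (-(I * t) * (s:ℂ)^2) := by
        rw [← Complex.exp_add]; push_cast; ring_nf
      rw [this, Complex.real_smul]
      push_cast [-Complex.ofReal_cos]
      field_simp
      rw [h2']
    rw [this, Complex.exp_ofReal_mul_I_re]
  · apply ContinuousOn.intervalIntegrable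
    apply ContinuousOn.mul (by fun_prop)
    simp only [Complex.real_smul, Function.comp]
    refine ContinuousOn.mul (by fun_prop) ?_
    apply ContinuousOn.mul (by fun_prop)
    exact Complex.continuous_ofReal.comp_continuousOn (hg.comp (by fun_prop) (by
      intro θ hθ; exact him ⟨θ, hθ, rfl⟩))

lemma deriv_contDiffAt {f : ℝ → ℝ} {u : ℝ} {m n : WithTop ℕ∞} (h : ContDiffAt ℝ n f u)
    (hmn : m + 1 ≤ n) : ContDiffAt ℝ m (deriv f) u := by
  have := (h.fderiv_right hmn).clm_apply (contDiffAt_const (c := (1:ℝ)))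
  exact this

lemma fres_bound (t : ℝ) (ht : 0 < t) (x : ℝ) (hx : 0 ≤ x) :
    ‖∫ u in (0:ℝ)..x, cexp (-(I * t) * (u:ℂ)^2)‖ ≤ 3 / √t := by
  have hs : 0 < √t := Real.sqrt_pos.2 ht
  have hst : √t ^ 2 = t := Real.sq_sqrt ht.le
  have hone : ∀ u : ℝ, ‖cexp (-(I * t) * (u:ℂ)^2)‖ ≤ 1 :=
    fun u => norm_cexp_neg (I * t) (by simp) u
  rcases le_or_gt (x * √t) 1 with h | h
  · have := intervalIntegral.norm_integral_le_of_norm_le_const (a := 0) (b := x) (C := 1)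
      (f := fun u : ℝ => cexp (-(I * t) * (u:ℂ)^2)) (fun u _ => hone u)
    rw [sub_zero, abs_of_nonneg hx, one_mul] at this
    refine this.trans ?_
    rw [le_div_iff₀ hs]; linarith
  · have hx0 : 0 < x := by
      rcases hx.eq_or_lt with h0 | h0
      · rw [← h0] at h; norm_num at h
      · exact h0
    have h1 := fres t ht x hx0
    rw [sqrt_val t ht] at h1
    have hA : ‖((√π / √t / √2 : ℝ) : ℂ) * (1 - I) / 2‖ ≤ 1 / √t := by
      have hI : ‖(1 - I : ℂ)‖ = √2 := by
        rw [Complex.norm_def]; congr 1; simp [Complex.normSq]; norm_num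
      rw [norm_div, norm_mul, hI, Complex.norm_real, Real.norm_eq_abs, abs_of_pos (by positivity)]
      have hpi : √π ≤ 2 := by
        rw [Real.sqrt_le_left (by norm_num)]; linarith [Real.pi_le_four]
      rw [div_mul_cancel₀ _ (by positivity), show ‖(2:ℂ)‖ = 2 by norm_num, div_div, div_le_div_iff₀ (by positivity) hs]
      nlinarith
    have hB : ‖cexp (-(I * t) * (x:ℂ)^2) / (2 * (I * t) * x)‖ ≤ 1 / √t := by
      rw [norm_div]
      have : ‖(2 * (I * t) * x : ℂ)‖ = 2 * t * x := by
        simp [abs_of_pos ht, abs_of_pos hx0]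
      rw [this, div_le_div_iff₀ (by positivity) hs]
      have h2 := hone x
      calc _ ≤ 1 * √t := by gcongr
        _ ≤ 1 * (2 * √t^2 * x) := by nlinarith
        _ = _ := by rw [hst]
    have hC : 1 / (2 * t^2 * x^3) ≤ 1 / √t := by
      apply one_div_le_one_div_of_le hs
      have h3 : (1:ℝ) ≤ (x * √t)^3 := one_le_pow₀ h.le
      calc √t ≤ 2 * √t * (x * √t)^3 := by nlinarith
        _ = 2 * (√t^2)^2 * x^3 := by ring
        _ = _ := by rw [hst]
    set G := ∫ u in (0:ℝ)..x, cexp (-(I * t) * (u:ℂ)^2)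
    set A := ((√π / √t / √2 : ℝ) : ℂ) * (1 - I) / 2
    set B := cexp (-(I * t) * (x:ℂ)^2) / (2 * (I * t) * x)
    have : G = (G - A + B) + A - B := by ring
    rw [this]
    have e : 3 / √t = 1 / √t + 1 / √t + 1 / √t := by ring
    rw [e]
    refine (norm_sub_le _ _).trans (add_le_add ((norm_add_le _ _).trans (add_le_add (h1.trans hC) hA)) hB)

lemma ww_facts : ∃ v v' : ℝ → ℝ, (∀ u ∈ Set.Icc (0:ℝ) 1, HasDerivAt ww (v u) u) ∧
    (∀ u ∈ Set.Icc (0:ℝ) 1, HasDerivAt v (v' u) u) ∧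
    ContinuousOn v (Set.Icc 0 1) ∧ ContinuousOn v' (Set.Icc 0 1) := by
  have h1 : ∀ u ∈ Set.Icc (0:ℝ) 1, ContDiffAt ℝ 1 (deriv ww) u := fun u hu =>
    deriv_contDiffAt (ww_contDiffAt hu) (by norm_num)
  have h2 : ∀ u ∈ Set.Icc (0:ℝ) 1, ContDiffAt ℝ 0 (deriv (deriv ww)) u := fun u hu =>
    deriv_contDiffAt (h1 u hu) (by norm_num)
  refine ⟨deriv ww, deriv (deriv ww), fun u hu => ?_, fun u hu => ?_, fun u hu => ?_, fun u hu => ?_⟩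
  · exact ((ww_contDiffAt hu).differentiableAt (by norm_num)).hasDerivAt
  · exact ((h1 u hu).differentiableAt (by norm_num)).hasDerivAt
  · exact (h1 u hu).continuousAt.continuousWithinAt
  · exact (h2 u hu).continuousAt.continuousWithinAt

lemma osc_bound : ∃ (M : ℝ) (v : ℝ → ℝ), 0 ≤ M ∧ (∀ u ∈ Set.Icc (0:ℝ) 1, HasDerivAt ww (v u) u) ∧
    ContinuousOn v (Set.Icc 0 1) ∧ ∀ t : ℝ, 0 < t →
    ‖∫ u in (0:ℝ)..1, cexp (-(I * t) * (u:ℂ)^2) * (v u : ℂ)‖ ≤ M / √t := by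
  obtain ⟨v, v', h1, h2, h3, h4⟩ := ww_facts
  obtain ⟨K, hK⟩ := isCompact_Icc.exists_bound_of_continuousOn h4
  have hK0 : 0 ≤ K := (norm_nonneg _).trans (hK 0 (by simp))
  refine ⟨3 * |v 1| + 3 * K, v, by positivity, h1, h3, fun t ht => ?_⟩
  have hu : Set.uIcc (0:ℝ) 1 = Set.Icc 0 1 := Set.uIcc_of_le (by norm_num)
  have hs : 0 < √t := Real.sqrt_pos.2 ht
  have hcE : Continuous (fun u : ℝ => cexp (-(I * t) * (u:ℂ)^2)) := by fun_prop
  set G : ℝ → ℂ := fun x => ∫ u in (0:ℝ)..x, cexp (-(I * t) * (u:ℂ)^2) with hG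
  have hGd : ∀ x : ℝ, HasDerivAt G (cexp (-(I * t) * (x:ℂ)^2)) x := fun x =>
    intervalIntegral.integral_hasDerivAt_right (hcE.intervalIntegrable _ _)
      (hcE.stronglyMeasurableAtFilter _ _) hcE.continuousAt
  have hv4 : ContinuousOn (fun u => (v' u : ℂ)) (Set.uIcc 0 1) := by
    rw [hu]; exact Complex.continuous_ofReal.comp_continuousOn h4
  have ibp := intervalIntegral.integral_deriv_mul_eq_sub (a := 0) (b := 1)
    (u := G) (u' := fun x : ℝ => cexp (-(I * t) * (x:ℂ)^2)) (v := fun u => (v u : ℂ))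
    (v' := fun u => (v' u : ℂ)) (fun x _ => hGd x)
    (fun x hx => (h2 x (hu ▸ hx)).ofReal_comp) (hcE.intervalIntegrable _ _)
    hv4.intervalIntegrable
  have hGc : Continuous G := continuous_iff_continuousAt.2 fun x => (hGd x).continuousAt
  rw [intervalIntegral.integral_add] at ibp
  · have hG0 : G 0 = 0 := by simp [hG]
    rw [hG0, zero_mul, sub_zero] at ibp
    rw [eq_sub_of_add_eq ibp]
    have e : (3 * |v 1| + 3 * K) / √t = 3 / √t * |v 1| + 3 / √t * K := by ring
    rw [e]
    refine (norm_sub_le _ _).trans (add_le_add ?_ ?_)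
    · rw [norm_mul, Complex.norm_real, Real.norm_eq_abs]
      have := fres_bound t ht 1 (by norm_num)
      gcongr
    · have := intervalIntegral.norm_integral_le_of_norm_le_const (a := 0) (b := 1) (C := 3 / √t * K)
        (f := fun u : ℝ => G u * (v' u : ℂ)) (fun u hu' => by
          rw [Set.uIoc_of_le (by norm_num)] at hu'
          rw [norm_mul, Complex.norm_real]
          have a1 := fres_bound t ht u hu'.1.le
          have a2 := hK u ⟨hu'.1.le, hu'.2⟩
          gcongr)
      simpa using this
  · apply ContinuousOn.intervalIntegrable
    apply ContinuousOn.mul hcE.continuousOn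
    rw [hu]; exact Complex.continuous_ofReal.comp_continuousOn h3
  · apply ContinuousOn.intervalIntegrable
    exact hGc.continuousOn.mul hv4

lemma int_expand (t : ℝ) (ht : 0 < t) (v : ℝ → ℝ)
    (h1 : ∀ u ∈ Set.Icc (0:ℝ) 1, HasDerivAt ww (v u) u) (h3 : ContinuousOn v (Set.Icc 0 1)) :
    (∫ u in (0:ℝ)..1, cexp (-(I * t) * (u:ℂ)^2) * (gg u : ℂ)) =
      (∫ u in (0:ℝ)..1, cexp (-(I * t) * (u:ℂ)^2)) + I / (2 * t) * (cexp (-(I * t)) * ww 1 -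
        ∫ u in (0:ℝ)..1, cexp (-(I * t) * (u:ℂ)^2) * (v u : ℂ)) := by
  have hu : Set.uIcc (0:ℝ) 1 = Set.Icc 0 1 := Set.uIcc_of_le (by norm_num)
  have ht0 : (t:ℂ) ≠ 0 := by exact_mod_cast ht.ne'
  have hcE : Continuous (fun u : ℝ => cexp (-(I * t) * (u:ℂ)^2)) := by fun_prop
  have hwc : ContinuousOn (fun u => (ww u : ℂ)) (Set.uIcc 0 1) := by
    rw [hu]
    exact Complex.continuous_ofReal.comp_continuousOn fun u hu => (h1 u hu).continuousAt.continuousWithinAt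
  have hvc : ContinuousOn (fun u => (v u : ℂ)) (Set.uIcc 0 1) := by
    rw [hu]; exact Complex.continuous_ofReal.comp_continuousOn h3
  have hE : ∀ u : ℝ, HasDerivAt (fun u : ℝ => cexp (-(I * t) * (u:ℂ)^2))
      (cexp (-(I * t) * (u:ℂ)^2) * (-(I * t) * (2 * u))) u := by
    intro u
    have h0 : HasDerivAt (fun u : ℝ => (u:ℂ)) 1 u := by
      simpa using (hasDerivAt_id u).ofReal_comp
    have := ((h0.pow 2).const_mul (-(I * t))).cexp
    simpa using this
  have ibp := intervalIntegral.integral_mul_deriv_eq_deriv_mul (a := 0) (b := 1)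
    (v := fun u : ℝ => cexp (-(I * t) * (u:ℂ)^2))
    (v' := fun u : ℝ => cexp (-(I * t) * (u:ℂ)^2) * (-(I * t) * (2 * u)))
    (u := fun u => (ww u : ℂ))
    (u' := fun u => (v u : ℂ)) 
    (fun x hx => (h1 x (hu ▸ hx)).ofReal_comp) (fun x _ => hE x)
    hvc.intervalIntegrable (Continuous.intervalIntegrable (by fun_prop) _ _)
  have hw0 : ww 0 = 0 := by simp [ww]
  have e1 : (∫ u in (0:ℝ)..1, cexp (-(I * t) * (u:ℂ)^2) * (gg u : ℂ)) =
      ∫ u in (0:ℝ)..1, (cexp (-(I * t) * (u:ℂ)^2) +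
        I / (2 * t) * ((ww u : ℂ) * (cexp (-(I * t) * (u:ℂ)^2) * (-(I * t) * (2 * u))))) := by
    refine intervalIntegral.integral_congr fun u hu' => ?_
    rw [gg_eq (hu ▸ hu')]
    push_cast
    field_simp
    linear_combination (u * ww u : ℂ) * Complex.I_sq
  rw [e1, intervalIntegral.integral_add, intervalIntegral.integral_const_mul, ibp, hw0]
  · have : (∫ u in (0:ℝ)..1, (v u : ℂ) * cexp (-(I * t) * (u:ℂ)^2)) =
      ∫ u in (0:ℝ)..1, cexp (-(I * t) * (u:ℂ)^2) * (v u : ℂ) := by simp only [mul_comm]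
    rw [this]
    simp
    left
    ring
  · exact hcE.intervalIntegrable _ _
  · apply ContinuousOn.intervalIntegrable
    apply ContinuousOn.mul (by fun_prop)
    apply ContinuousOn.mul hwc (by fun_prop)


/-- Asymptotics of `J₀`: there is `C > 0` such that for all `t ≥ 1`,
`|J₀(t) − (cos t + sin t)/√(π t)| ≤ C t^{−3/2}`. -/
theorem besselJ_zero_asymptotic :
    ∃ C > (0:ℝ), ∀ t : ℝ, 1 ≤ t →
      ‖besselJ 0 t - (((Real.cos t + Real.sin t) / Real.sqrt (Real.pi * t) : ℝ) : ℂ)‖ ≤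
        C * t ^ (-(3:ℝ)/2) := by
  obtain ⟨M, v, hM, h1, h3, hb⟩ := osc_bound
  refine ⟨2 / π * √2 * (1 + M), by positivity, fun t ht1 => ?_⟩
  have ht : 0 < t := by linarith
  have ht0 : (t:ℂ) ≠ 0 := by exact_mod_cast ht.ne'
  have hs : 0 < √t := Real.sqrt_pos.2 ht
  have hst : √t ^ 2 = t := Real.sq_sqrt ht.le
  have hs1 : 1 ≤ √t := Real.one_le_sqrt.2 ht1
  have hpow : t ^ (-(3:ℝ)/2) = 1 / (t * √t) := by
    rw [show -(3:ℝ)/2 = -(1 + 1/2) by norm_num, Real.rpow_neg ht.le, Real.rpow_add ht,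
      Real.rpow_one, ← Real.sqrt_eq_rpow, one_div]
  rw [bessel_real, subst_int, int_expand t ht v h1 h3, ← Complex.ofReal_sub, Complex.norm_real]
  have hf := fres t ht 1 one_pos
  have hv := hb t ht
  rw [sqrt_val t ht] at hf
  set G := ∫ u in (0:ℝ)..1, cexp (-(I * t) * (u:ℂ)^2)
  set V := ∫ u in (0:ℝ)..1, cexp (-(I * t) * (u:ℂ)^2) * (v u : ℂ)
  have hE : cexp (I * t) * cexp (-(I * t)) = 1 := by rw [← Complex.exp_add]; simp
  simp only [Complex.ofReal_one, one_pow, mul_one] at hf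
  set R := G - ((√π / √t / √2 : ℝ) : ℂ) * (1 - I) / 2 + cexp (-(I * t)) / (2 * (I * t)) with hR
  have hdec : cexp (I * t) * (G + I / (2 * t) * (cexp (-(I * t)) * ww 1 - V)) =
      cexp (I * t) * (R - I / (2 * t) * V) + ((√π / √t / √2 / 2 : ℝ) : ℂ) * (cexp (I * t) * (1 - I))
       + (((1 + ww 1) / (2 * t) : ℝ) : ℂ) * I := by
    have hI : 1 / (2 * (I * t)) = - I / (2 * t) := by
      field_simp; simp
    have hR' : G = R + ((√π / √t / √2 : ℝ) : ℂ) * (1 - I) / 2 - cexp (-(I * t)) * (1 / (2 * (I * t))) := by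
      rw [hR]; ring
    rw [hR', hI]
    push_cast
    linear_combination (I / (2 * t) * (1 + ww 1)) * hE
  have hre : (cexp (I * t) * (1 - I)).re = Real.cos t + Real.sin t := by
    rw [mul_comm I, Complex.mul_re, Complex.exp_ofReal_mul_I_re, Complex.exp_ofReal_mul_I_im]
    simp
  have hmain : 2 / π * (√2 * (√π / √t / √2 / 2 * (Real.cos t + Real.sin t))) =
      (Real.cos t + Real.sin t) / √(π * t) := by
    rw [Real.sqrt_mul Real.pi_pos.le]
    have hpp : √π ^ 2 = π := Real.sq_sqrt Real.pi_pos.le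
    have : 0 < √π := Real.sqrt_pos.2 Real.pi_pos
    rw [← hpp, Real.sqrt_sq this.le]
    field_simp
  rw [hdec, Complex.add_re, Complex.add_re, Complex.re_ofReal_mul, hre, Complex.re_ofReal_mul,
    Complex.I_re, mul_zero, add_zero, mul_add, mul_add, hmain, add_sub_cancel_right]
  have hnE : ‖cexp (I * t)‖ = 1 := by rw [mul_comm]; exact Complex.norm_exp_ofReal_mul_I t
  have hRb : ‖R‖ ≤ 1 / (t * √t) := by
    refine hf.trans (one_div_le_one_div_of_le (by positivity) ?_)
    have : √t ≤ t := by nlinarith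
    nlinarith
  have hVb : ‖I / (2 * t) * V‖ ≤ M / (t * √t) := by
    rw [norm_mul, norm_div, norm_mul, Complex.norm_I, Complex.norm_real, Real.norm_eq_abs,
      abs_of_pos ht, show ‖(2:ℂ)‖ = 2 by norm_num]
    calc _ ≤ 1 / (2 * t) * (M / √t) := by gcongr
      _ ≤ 1 / t * (M / √t) := by gcongr; linarith
      _ = _ := by field_simp
  have hfin : |(cexp (I * t) * (R - I / (2 * t) * V)).re| ≤ (1 + M) / (t * √t) := by
    refine (Complex.abs_re_le_norm _).trans ?_
    rw [norm_mul, hnE, one_mul, add_div]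
    exact (norm_sub_le _ _).trans (add_le_add hRb hVb)
  rw [Real.norm_eq_abs, abs_mul, abs_mul, abs_of_pos (show 0 < 2 / π by positivity),
    abs_of_pos (show 0 < √2 by positivity), hpow]
  calc _ ≤ 2 / π * (√2 * ((1 + M) / (t * √t))) := by gcongr
    _ = _ := by ring
end

section
/- There exists a constant C > 0 such that for all real t ≥ 1, |J₁(t) − (sin t − cos t)/√(π t)| ≤ C t^{−3/2}. -/
open Complex Real MeasureTheory

namespace BJ

noncomputable def cc : ℂ := (Real.pi / I : ℂ) ^ (1 / 2 : ℂ) / 2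

lemma cc_eq : cc = (Real.sqrt Real.pi / 2 : ℝ) * ((1 - I) / (Real.sqrt 2 : ℝ)) := by
  unfold cc
  have h1 : (Real.pi / I : ℂ) = (Real.pi : ℝ) * (-I) := by
    rw [div_I]; ring
  have h2 : ((1:ℂ)/2) = ((1/2 : ℝ) : ℂ) := by push_cast; rfl
  have h3 : Complex.log (-I) = -(Real.pi/2) * I := by
    rw [Complex.log_neg_I]
  have h4 : (-I : ℂ) ^ ((1:ℂ)/2) = (1 - I) / (Real.sqrt 2 : ℝ) := by
    rw [Complex.cpow_def_of_ne_zero (by simp), h3]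
    have : (-(Real.pi/2) * I * (1/2) : ℂ) = ((-(Real.pi/4) : ℝ) : ℂ) * I := by
      push_cast; ring
    rw [this, Complex.exp_mul_I, ← Complex.ofReal_cos, ← Complex.ofReal_sin, Real.cos_neg,
      Real.sin_neg, Real.cos_pi_div_four, Real.sin_pi_div_four]
    have hs : (Real.sqrt 2 : ℂ) ≠ 0 := by simp
    have hs2 : (Real.sqrt 2 : ℂ)^2 = 2 := by
      rw [← Complex.ofReal_pow, Real.sq_sqrt (by norm_num)]; norm_num
    push_cast
    field_simp
    rw [hs2]; ring
  have h5 : ((Real.pi : ℝ) * (-I) : ℂ) ^ ((1:ℂ)/2) = (Real.pi : ℂ) ^ ((1:ℂ)/2) * (-I : ℂ) ^ ((1:ℂ)/2) := by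
    have hp : (Real.pi : ℂ) ≠ 0 := by exact_mod_cast Real.pi_ne_zero
    rw [Complex.cpow_def_of_ne_zero (mul_ne_zero hp (by simp)), Complex.cpow_def_of_ne_zero hp,
      Complex.cpow_def_of_ne_zero (by simp), Complex.log_ofReal_mul Real.pi_pos (by simp),
      add_mul, Complex.exp_add, Complex.ofReal_log Real.pi_pos.le]
  rw [h1, h5, h4, h2, ← Complex.ofReal_cpow Real.pi_pos.le, ← Real.sqrt_eq_rpow]
  push_cast; ring

/-- regularised Fresnel expression -/
noncomputable def D (b : ℂ) (y : ℝ) : ℂ :=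
  (∫ x in (0:ℝ)..y, cexp (-b * (x:ℂ)^2)) + cexp (-b * (y:ℂ)^2) / (2 * b * y)
    - cexp (-b * (y:ℂ)^2) / (4 * b^2 * y^3)

lemma hasDerivAt_exp (b : ℂ) (y : ℝ) :
    HasDerivAt (fun y : ℝ => cexp (-b * (y:ℂ)^2)) (cexp (-b * (y:ℂ)^2) * (-b * (2 * y))) y := by
  have h : HasDerivAt (fun z : ℂ => cexp (-b * z^2)) (cexp (-b * (y:ℂ)^2) * (-b * (2 * y))) (y:ℂ) := by
    have := ((hasDerivAt_pow 2 (y:ℂ)).const_mul (-b)).cexp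
    simpa using this
  exact h.comp_ofReal

lemma hasDerivAt_int (b : ℂ) (y : ℝ) :
    HasDerivAt (fun y : ℝ => ∫ x in (0:ℝ)..y, cexp (-b * (x:ℂ)^2)) (cexp (-b * (y:ℂ)^2)) y := by
  have hc : Continuous (fun x : ℝ => cexp (-b * (x:ℂ)^2)) := by fun_prop
  exact hc.integral_hasStrictDerivAt 0 y |>.hasDerivAt

lemma hasDerivAt_D (b : ℂ) (hb : b ≠ 0) (y : ℝ) (hy : 0 < y) :
    HasDerivAt (D b) (3 * cexp (-b * (y:ℂ)^2) / (4 * b^2 * y^4)) y := by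
  have hy' : (y:ℂ) ≠ 0 := by exact_mod_cast hy.ne'
  have hid : HasDerivAt (fun y : ℝ => (y:ℂ)) 1 y := (hasDerivAt_id y).ofReal_comp
  have h1 := (hasDerivAt_exp b y).div (hid.const_mul (2*b)) (by simp [hb, hy'])
  have h2 := (hasDerivAt_exp b y).div ((hid.pow 3).const_mul (4*b^2)) (by simp [hb, hy'])
  have h := ((hasDerivAt_int b y).add h1).sub h2
  refine h.congr_deriv ?_
  simp only [Pi.pow_apply]
  field_simp
  push_cast
  ring

lemma D_diff (b : ℂ) (hb : 1 ≤ ‖b‖) (hre : 0 ≤ b.re) (y z : ℝ) (hy : 1 ≤ y) (hz : y ≤ z) :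
    ‖D b z - D b y‖ ≤ 1 / (y^3) := by
  have hb0 : b ≠ 0 := by
    rintro rfl; simp at hb; linarith
  have key : ∀ x ∈ Set.Icc y z, ‖D b x - D b y‖ ≤ 1 / y^3 - 1 / x^3 := by
    have hd : ∀ x ∈ Set.Icc y z, HasDerivAt (fun x : ℝ => 1 / y^3 - 1/x^3) (3 / x^4) x := by
      intro x hx
      have hx0 : x ≠ 0 := by linarith [hx.1]
      have := ((hasDerivAt_const x (1:ℝ)).div (hasDerivAt_pow 3 x) (by positivity)).const_sub (1/y^3)
      refine this.congr_deriv ?_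
      field_simp
      ring
    refine image_norm_le_of_norm_deriv_right_le_deriv_boundary' (f := fun x => D b x - D b y) (f' := fun x => 3 * cexp (-b * (x:ℂ)^2) / (4 * b^2 * x^4)) (B' := fun x => 3 / x^4) ?_ ?_ ?_ ?_ ?_ ?_
    · intro x hx
      exact ((hasDerivAt_D b hb0 x (by linarith [hx.1])).sub_const _).continuousAt.continuousWithinAt
    · intro x hx
      exact ((hasDerivAt_D b hb0 x (by linarith [hx.1])).sub_const _).hasDerivWithinAt
    · simp
    · intro x hx
      exact (hd x hx).continuousAt.continuousWithinAt
    · intro x hx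
      exact (hd x ⟨hx.1, hx.2.le⟩).hasDerivWithinAt
    · intro x hx
      have hx0 : 0 < x := by linarith [hx.1]
      have he : ‖cexp (-b * (x:ℂ)^2)‖ ≤ 1 := by
        rw [Complex.norm_exp, ← Complex.ofReal_pow, Complex.re_mul_ofReal]
        apply Real.exp_le_one_iff.2
        simp only [Complex.neg_re]
        nlinarith [mul_nonneg hre (sq_nonneg x)]
      simp only [norm_div, norm_mul, norm_pow, Complex.norm_real, Real.norm_eq_abs, abs_of_pos hx0]
      norm_num
      have hb2 : 1 ≤ ‖b‖^2 := one_le_pow₀ hb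
      rw [div_le_div_iff₀ (by positivity) (by positivity)]
      have h4 : 0 < x^4 := by positivity
      rw [neg_mul] at he
      nlinarith [mul_le_mul_of_nonneg_right he h4.le, mul_le_mul_of_nonneg_right hb2 h4.le]
  refine (key z ⟨hz, le_rfl⟩).trans ?_
  have : 0 < z := by linarith
  have : 0 ≤ 1 / z^3 := by positivity
  linarith

lemma D_lim (b : ℂ) (hb : 1 ≤ ‖b‖) (hre : 0 < b.re) :
    Filter.Tendsto (D b) Filter.atTop (nhds ((Real.pi / b : ℂ) ^ (1 / 2 : ℂ) / 2)) := by
  have hb0 : b ≠ 0 := by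
    rintro rfl; simp at hre
  have h1 := MeasureTheory.intervalIntegral_tendsto_integral_Ioi (μ := volume) (0:ℝ) (integrable_cexp_neg_mul_sq hre).integrableOn Filter.tendsto_id
  rw [integral_gaussian_complex_Ioi hre] at h1
  have he : ∀ x : ℝ, ‖cexp (-b * (x:ℂ)^2)‖ ≤ 1 := by
    intro x
    rw [Complex.norm_exp, ← Complex.ofReal_pow, Complex.re_mul_ofReal]
    apply Real.exp_le_one_iff.2
    simp only [Complex.neg_re]
    nlinarith [mul_nonneg hre.le (sq_nonneg x)]
  have ht : Filter.Tendsto (fun y : ℝ => y⁻¹) Filter.atTop (nhds 0) := tendsto_inv_atTop_zero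
  have h2 : Filter.Tendsto (fun y : ℝ => cexp (-b * (y:ℂ)^2) / (2 * b * y)) Filter.atTop (nhds 0) := by
    apply squeeze_zero_norm' _ ht
    filter_upwards [Filter.eventually_ge_atTop 1] with y hy
    have hy0 : 0 < y := by linarith
    simp only [norm_div, norm_mul, norm_pow, Complex.norm_real, Real.norm_eq_abs, abs_of_pos hy0]
    rw [inv_eq_one_div]
    refine div_le_div₀ (by norm_num) (he y) hy0 ?_
    norm_num
    nlinarith
  have h3 : Filter.Tendsto (fun y : ℝ => cexp (-b * (y:ℂ)^2) / (4 * b^2 * y^3)) Filter.atTop (nhds 0) := by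
    apply squeeze_zero_norm' _ ht
    filter_upwards [Filter.eventually_ge_atTop 1] with y hy
    have hy0 : 0 < y := by linarith
    simp only [norm_div, norm_mul, norm_pow, Complex.norm_real, Real.norm_eq_abs, abs_of_pos hy0]
    rw [inv_eq_one_div]
    refine div_le_div₀ (by norm_num) (he y) hy0 ?_
    norm_num
    have hb2 : 1 ≤ ‖b‖^2 := one_le_pow₀ hb
    have hy3 : y ≤ y^3 := le_self_pow₀ hy (by norm_num)
    nlinarith
  have h := (h1.add h2).sub h3
  simp only [add_zero, sub_zero] at h
  exact h

lemma D_bound (b : ℂ) (hb : 1 ≤ ‖b‖) (hre : 0 < b.re) (y : ℝ) (hy : 1 ≤ y) :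
    ‖(Real.pi / b : ℂ) ^ (1 / 2 : ℂ) / 2 - D b y‖ ≤ 1 / y^3 := by
  refine le_of_tendsto ((D_lim b hb hre).sub_const (D b y)).norm ?_
  filter_upwards [Filter.eventually_ge_atTop y] with z hz
  exact D_diff b hb hre.le y z hy hz

lemma D_bound_I (y : ℝ) (hy : 1 ≤ y) : ‖cc - D I y‖ ≤ 1 / y^3 := by
  have hy0 : (y:ℂ) ≠ 0 := by
    have : y ≠ 0 := by linarith
    exact_mod_cast this
  have hbc : Continuous (fun e : ℝ => (e:ℂ) + I) := by fun_prop
  have hb0 : ((0:ℝ):ℂ) + I = I := by simp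
  have hD : ContinuousAt (fun e : ℝ => (Real.pi / ((e:ℂ) + I) : ℂ) ^ (1 / 2 : ℂ) / 2 - D ((e:ℂ) + I) y) 0 := by
    have hint : Continuous (fun e : ℝ => ∫ x in (0:ℝ)..y, cexp (-((e:ℂ) + I) * (x:ℂ)^2)) := by
      apply intervalIntegral.continuous_parametric_intervalIntegral_of_continuous'
      fun_prop
    have hcp : ContinuousAt (fun e : ℝ => (Real.pi / ((e:ℂ) + I) : ℂ) ^ (1 / 2 : ℂ)) 0 := by
      apply ContinuousAt.cpow
      · exact continuousAt_const.div hbc.continuousAt (by simp)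
      · exact continuousAt_const
      · right
        simp [Real.pi_ne_zero]
    unfold D
    refine (hcp.div_const _).sub ((hint.continuousAt.add ?_).sub ?_)
    · refine ContinuousAt.div (by fun_prop) (by fun_prop) ?_
      simp [hy0]
    · refine ContinuousAt.div (by fun_prop) (by fun_prop) ?_
      simp [hy0]
  have hlim : Filter.Tendsto (fun e : ℝ => (Real.pi / ((e:ℂ) + I) : ℂ) ^ (1 / 2 : ℂ) / 2 - D ((e:ℂ) + I) y) (nhdsWithin 0 (Set.Ioi 0)) (nhds (cc - D I y)) := by
    have := hD.tendsto.mono_left (nhdsWithin_le_nhds (s := Set.Ioi 0))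
    simpa only [hb0, cc] using this
  refine le_of_tendsto hlim.norm ?_
  filter_upwards [self_mem_nhdsWithin] with e he
  apply D_bound _ _ _ y hy
  · have := Complex.abs_im_le_norm ((e:ℂ) + I)
    simpa using this
  · simpa using he

noncomputable def G (y : ℝ) : ℂ := (∫ x in (0:ℝ)..y, cexp (-I * (x:ℂ)^2)) - cc
noncomputable def Psi (y : ℝ) : ℂ :=
  y^2 * G y / 2 + y * cexp (-I * (y:ℂ)^2) / (4 * I) - G y / (4 * I)

lemma hasDerivAt_G (y : ℝ) : HasDerivAt G (cexp (-I * (y:ℂ)^2)) y :=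
  (hasDerivAt_int I y).sub_const _

lemma hasDerivAt_Psi (y : ℝ) : HasDerivAt Psi (y * G y) y := by
  have hid : HasDerivAt (fun y : ℝ => (y:ℂ)) 1 y := (hasDerivAt_id y).ofReal_comp
  have h1 := (((hid.pow 2).mul (hasDerivAt_G y)).div_const 2)
  have h2 := (hid.mul (hasDerivAt_exp I y)).div_const (4*I)
  have h3 := (hasDerivAt_G y).div_const (4*I)
  refine ((h1.add h2).sub h3).congr_deriv ?_
  simp only [Pi.pow_apply]
  have := I_ne_zero
  field_simp
  push_cast
  ring

lemma Psi_bound : ∃ K > 0, ∀ y : ℝ, 0 ≤ y → ‖Psi y‖ ≤ K := by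
  have hc : Continuous Psi := continuous_iff_continuousAt.2 fun y => (hasDerivAt_Psi y).continuousAt
  obtain ⟨K, hK⟩ := (isCompact_Icc (a := (0:ℝ)) (b := 1)).exists_bound_of_continuousOn hc.continuousOn
  refine ⟨max K 10, by positivity, fun y hy => ?_⟩
  rcases le_total y 1 with h | h
  · exact (hK y ⟨hy, h⟩).trans (le_max_left _ _)
  refine le_trans ?_ (le_max_right _ _)
  have hy0 : 0 < y := by linarith
  have hyc : (y:ℂ) ≠ 0 := by exact_mod_cast hy0.ne'
  have hD := D_bound_I y h
  set E := cexp (-I * (y:ℂ)^2) with hE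
  have hEn : ‖E‖ = 1 := by
    rw [hE, show -I * (y:ℂ)^2 = ((-(y^2) : ℝ) : ℂ) * I by push_cast; ring]
    exact Complex.norm_exp_ofReal_mul_I _
  have hG : G y = -(cc - D I y) - E / (2 * I * y) + E / (4 * I^2 * y^3) := by
    unfold G D; rw [← hE]; ring
  have hP : Psi y = -(cc - D I y) * y^2 / 2 + (cc - D I y) / (4*I) - E / (16 * I * (y:ℂ)^3 * I^2) 
      + (E / (8 * I^2 * y) + E / (8*I^2*y)) := by
    unfold Psi; rw [← hE, hG]
    field_simp
    ring_nf
  rw [hP]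
  have hy1 : 1 / y ≤ 1 := by rw [div_le_one hy0]; exact h
  have hy3 : 1 / y^3 ≤ 1 := by rw [div_le_one (by positivity)]; exact one_le_pow₀ h
  have n1 : ‖-(cc - D I y) * y^2 / 2‖ ≤ 1 := by
    simp only [norm_div, norm_mul, norm_neg, norm_pow, Complex.norm_real, Real.norm_eq_abs, abs_of_pos hy0]
    norm_num
    have : ‖cc - D I y‖ * y^2 ≤ 1 / y^3 * y^2 := by gcongr
    have h2 : 1 / y^3 * y^2 = 1/y := by field_simp
    linarith
  have n2 : ‖(cc - D I y) / (4*I)‖ ≤ 1 := by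
    simp only [norm_div, norm_mul, Complex.norm_I]
    norm_num
    linarith
  have n3 : ‖E / (16 * I * (y:ℂ)^3 * I^2)‖ ≤ 1 := by
    simp only [norm_div, norm_mul, norm_pow, Complex.norm_I, hEn, Complex.norm_real, Real.norm_eq_abs, abs_of_pos hy0]
    norm_num
    rw [one_div] at hy3
    have : 0 < (y^3)⁻¹ := by positivity
    linarith
  have n4 : ‖E / (8 * I^2 * y)‖ ≤ 1 := by
    simp only [norm_div, norm_mul, norm_pow, Complex.norm_I, hEn, Complex.norm_real, Real.norm_eq_abs, abs_of_pos hy0]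
    norm_num
    rw [one_div] at hy1
    have : 0 < (y)⁻¹ := by positivity
    linarith
  refine (norm_add_le _ _).trans ?_
  have a := norm_add_le (E / (8 * I^2 * y)) (E / (8*I^2*y))
  have b := norm_sub_le (-(cc - D I y) * y^2 / 2 + (cc - D I y) / (4*I)) (E / (16 * I * (y:ℂ)^3 * I^2))
  have c := norm_add_le (-(cc - D I y) * y^2 / 2) ((cc - D I y) / (4*I))
  linarith

end BJ

namespace BJ

lemma bessel_eq (t : ℝ) : besselJ 1 t =
    ((2 / Real.pi * (∫ θ in (0:ℝ)..(Real.pi/2), cexp (I * (t * Real.cos θ)) * (Real.cos θ : ℂ)).im : ℝ) : ℂ) := by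
  unfold besselJ
  set f : ℝ → ℂ := fun φ => Complex.exp (Complex.I * ((t : ℂ) * (Real.sin φ : ℂ) - ((1:ℤ) : ℂ) * (φ : ℂ))) with hf
  have hfc : Continuous f := by fun_prop
  have hi : ∀ a b, IntervalIntegrable f volume a b := fun a b => hfc.intervalIntegrable a b
  have hsplit : ∫ φ in (-Real.pi)..Real.pi, f φ =
      (∫ φ in (-Real.pi)..(-(Real.pi/2)), f φ) + (∫ φ in (-(Real.pi/2))..0, f φ)
      + (∫ φ in 0..(Real.pi/2), f φ) + (∫ φ in (Real.pi/2)..Real.pi, f φ) := by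
    rw [intervalIntegral.integral_add_adjacent_intervals (hi _ _) (hi _ _),
      intervalIntegral.integral_add_adjacent_intervals (hi _ _) (hi _ _),
      intervalIntegral.integral_add_adjacent_intervals (hi _ _) (hi _ _)]
  have e1 : ∫ φ in (-Real.pi)..(-(Real.pi/2)), f φ = ∫ θ in (0:ℝ)..(Real.pi/2), f (-(Real.pi/2) - θ) := by
    rw [intervalIntegral.integral_comp_sub_left]; congr 1 <;> ring
  have e2 : ∫ φ in (-(Real.pi/2))..0, f φ = ∫ θ in (0:ℝ)..(Real.pi/2), f (-(Real.pi/2) + θ) := by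
    rw [intervalIntegral.integral_comp_add_left]; congr 1 <;> ring
  have e3 : ∫ φ in 0..(Real.pi/2), f φ = ∫ θ in (0:ℝ)..(Real.pi/2), f (Real.pi/2 - θ) := by
    rw [intervalIntegral.integral_comp_sub_left]; congr 1 <;> ring
  have e4 : ∫ φ in (Real.pi/2)..Real.pi, f φ = ∫ θ in (0:ℝ)..(Real.pi/2), f (Real.pi/2 + θ) := by
    rw [intervalIntegral.integral_comp_add_left]; congr 1 <;> ring
  have hsum : ∫ φ in (-Real.pi)..Real.pi, f φ =
      ∫ θ in (0:ℝ)..(Real.pi/2), ((4 * (Real.cos θ * Real.sin (t * Real.cos θ)) : ℝ) : ℂ) := by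
    rw [hsplit, e1, e2, e3, e4,
      ← intervalIntegral.integral_add (by apply Continuous.intervalIntegrable; fun_prop) (by apply Continuous.intervalIntegrable; fun_prop),
      ← intervalIntegral.integral_add (by apply Continuous.intervalIntegrable; fun_prop) (by apply Continuous.intervalIntegrable; fun_prop),
      ← intervalIntegral.integral_add (by apply Continuous.intervalIntegrable; fun_prop) (by apply Continuous.intervalIntegrable; fun_prop)]
    congr 1
    ext θ
    have s1 : Real.sin (-(Real.pi/2) - θ) = - Real.cos θ := by
      rw [show -(Real.pi/2) - θ = -(θ + Real.pi/2) by ring, Real.sin_neg, Real.sin_add_pi_div_two]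
    have s2 : Real.sin (-(Real.pi/2) + θ) = - Real.cos θ := by
      rw [show -(Real.pi/2) + θ = -(Real.pi/2 - θ) by ring, Real.sin_neg, Real.sin_pi_div_two_sub]
    have s3 : Real.sin (Real.pi/2 - θ) = Real.cos θ := Real.sin_pi_div_two_sub θ
    have s4 : Real.sin (Real.pi/2 + θ) = Real.cos θ := by
      rw [add_comm, Real.sin_add_pi_div_two]
    simp only [hf, s1, s2, s3, s4]
    have hp : cexp (Real.pi/2 * I) = I := Complex.exp_pi_div_two_mul_I
    have hm : cexp (-(Real.pi/2 * I)) = -I := by rw [Complex.exp_neg, hp, Complex.inv_I]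
    have r1 : cexp (I * (t * ((-Real.cos θ : ℝ):ℂ) - ((1:ℤ):ℂ) * ((-(Real.pi/2) - θ : ℝ):ℂ)))
        = cexp (-(t * Real.cos θ * I)) * I * cexp (θ * I) := by
      rw [show cexp (-(t * Real.cos θ * I)) * I * cexp (θ * I) = cexp (-(t * Real.cos θ * I)) * cexp (Real.pi/2 * I) * cexp (θ * I) by rw [hp], ← Complex.exp_add, ← Complex.exp_add]; congr 1; push_cast; ring
    have r2 : cexp (I * (t * ((-Real.cos θ : ℝ):ℂ) - ((1:ℤ):ℂ) * ((-(Real.pi/2) + θ : ℝ):ℂ)))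
        = cexp (-(t * Real.cos θ * I)) * I * cexp (-(θ * I)) := by
      rw [show cexp (-(t * Real.cos θ * I)) * I * cexp (-(θ * I)) = cexp (-(t * Real.cos θ * I)) * cexp (Real.pi/2 * I) * cexp (-(θ * I)) by rw [hp], ← Complex.exp_add, ← Complex.exp_add]; congr 1; push_cast; ring
    have r3 : cexp (I * (t * ((Real.cos θ : ℝ):ℂ) - ((1:ℤ):ℂ) * ((Real.pi/2 - θ : ℝ):ℂ)))
        = cexp ((t * Real.cos θ * I)) * (-I) * cexp (θ * I) := by
      rw [← hm, ← Complex.exp_add, ← Complex.exp_add]; congr 1; push_cast; ring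
    have r4 : cexp (I * (t * ((Real.cos θ : ℝ):ℂ) - ((1:ℤ):ℂ) * ((Real.pi/2 + θ : ℝ):ℂ)))
        = cexp ((t * Real.cos θ * I)) * (-I) * cexp (-(θ * I)) := by
      rw [← hm, ← Complex.exp_add, ← Complex.exp_add]; congr 1; push_cast; ring
    rw [r1, r2, r3, r4]
    push_cast
    rw [Complex.sin, Complex.cos]
    simp only [neg_mul]
    ring
  rw [hsum, intervalIntegral.integral_ofReal]
  have him : (∫ θ in (0:ℝ)..(Real.pi/2), cexp (I * (t * Real.cos θ)) * (Real.cos θ : ℂ)).im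
      = ∫ θ in (0:ℝ)..(Real.pi/2), Real.cos θ * Real.sin (t * Real.cos θ) := by
    have hint : IntervalIntegrable (fun θ : ℝ => cexp (I * (t * Real.cos θ)) * (Real.cos θ : ℂ)) volume 0 (Real.pi/2) := by
      apply Continuous.intervalIntegrable; fun_prop
    have := Complex.imCLM.intervalIntegral_comp_comm hint
    simp only [Complex.imCLM_apply] at this
    rw [← this]
    congr 1
    ext θ
    rw [Complex.im_mul_ofReal, show I * ((t:ℂ) * Real.cos θ) = ((t * Real.cos θ : ℝ) : ℂ) * I by push_cast; ring,
      Complex.exp_ofReal_mul_I_im, mul_comm]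
  rw [him, intervalIntegral.integral_const_mul]
  push_cast
  ring

lemma main_int (K : ℝ) (hK : 0 < K) (hPsi : ∀ y : ℝ, 0 ≤ y → ‖Psi y‖ ≤ K) (t : ℝ) (ht : 1 ≤ t) :
    ‖(∫ θ in (0:ℝ)..(Real.pi/2), cexp (I * (t * Real.cos θ)) * (Real.cos θ : ℂ))
      - cexp (I * t) * ((Real.sqrt 2 / Real.sqrt t : ℝ) * cc)‖ ≤ 100 * K / (Real.sqrt t)^3 := by
  set σ := Real.sqrt t with hσ
  have ht0 : 0 < t := by linarith
  have hσ0 : 0 < σ := Real.sqrt_pos.2 ht0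
  have hσ2 : σ^2 = t := Real.sq_sqrt ht0.le
  have hσc : (σ:ℂ) ≠ 0 := by exact_mod_cast hσ0.ne'
  set w := Real.sqrt 2 with hw
  have hw2 : w^2 = 2 := Real.sq_sqrt (by norm_num)
  have hw0 : 0 < w := Real.sqrt_pos.2 (by norm_num)
  have hwl : w ≤ 3/2 := by nlinarith
  have hpi := Real.pi_pos
  have hcos : ∀ θ ∈ Set.Icc (0:ℝ) (Real.pi/2), 7/10 ≤ Real.cos (θ/2) := by
    intro θ hθ
    have : Real.cos (Real.pi/4) ≤ Real.cos (θ/2) := by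
      apply Real.cos_le_cos_of_nonneg_of_le_pi <;> linarith [hθ.1, hθ.2]
    rw [Real.cos_pi_div_four] at this
    have : 7/5 ≤ w := by nlinarith
    linarith
  have hsin : ∀ θ ∈ Set.Icc (0:ℝ) (Real.pi/2), 0 ≤ Real.sin (θ/2) := by
    intro θ hθ
    apply Real.sin_nonneg_of_nonneg_of_le_pi <;> linarith [hθ.1, hθ.2]
  let y : ℝ → ℝ := fun θ => σ * w * Real.sin (θ/2)
  let q : ℝ → ℝ := fun θ => w * (2 * Real.cos (θ/2) - (Real.cos (θ/2))⁻¹)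
  let r : ℝ → ℝ := fun θ => w * (-(Real.cos (θ/2))⁻¹ - (Real.cos (θ/2))⁻¹^3/2)
  let r' : ℝ → ℝ := fun θ => w * (-Real.sin (θ/2) / (2 * Real.cos (θ/2)^2) - 3 * Real.sin (θ/2) / (4 * Real.cos (θ/2)^4))
  let A : ℝ → ℂ := fun θ => (σ:ℂ)⁻¹ * G (y θ)
  let B : ℝ → ℂ := fun θ => (σ:ℂ)⁻¹^3 * Psi (y θ)
  have dhalf : ∀ θ : ℝ, HasDerivAt (fun θ : ℝ => θ/2) (1/2) θ := fun θ => (hasDerivAt_id θ).div_const 2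
  have dc : ∀ θ : ℝ, HasDerivAt (fun θ : ℝ => Real.cos (θ/2)) (-Real.sin (θ/2) * (1/2)) θ := fun θ => (dhalf θ).cos
  have dy : ∀ θ, HasDerivAt y (σ * w * (Real.cos (θ/2) * (1/2))) θ := fun θ =>
    ((dhalf θ).sin).const_mul (σ*w)
  have dA : ∀ θ, HasDerivAt A ((σ:ℂ)⁻¹ * ((σ * w * (Real.cos (θ/2) * (1/2)) : ℝ) • cexp (-I * (y θ:ℂ)^2))) θ := fun θ =>
    (((hasDerivAt_G (y θ)).scomp θ (dy θ))).const_mul _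
  have dB : ∀ θ, HasDerivAt B ((σ:ℂ)⁻¹^3 * ((σ * w * (Real.cos (θ/2) * (1/2)) : ℝ) • (y θ * G (y θ)))) θ := fun θ =>
    (((hasDerivAt_Psi (y θ)).scomp θ (dy θ))).const_mul _
  have dq : ∀ θ ∈ Set.Icc (0:ℝ) (Real.pi/2), HasDerivAt q (w * (- Real.sin (θ/2) - Real.sin (θ/2) / (2 * Real.cos (θ/2)^2))) θ := by
    intro θ hθ
    have hc : Real.cos (θ/2) ≠ 0 := by linarith [hcos θ hθ]
    refine ((((dc θ).const_mul 2).sub ((dc θ).inv hc)).const_mul w).congr_deriv ?_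
    field_simp
  have dr : ∀ θ ∈ Set.Icc (0:ℝ) (Real.pi/2), HasDerivAt r (r' θ) θ := by
    intro θ hθ
    have hc : Real.cos (θ/2) ≠ 0 := by linarith [hcos θ hθ]
    refine (((((dc θ).inv hc).neg).sub ((((dc θ).inv hc).pow 3).div_const 2)).const_mul w).congr_deriv ?_
    simp only [r', Pi.inv_apply, Nat.reduceSub]
    field_simp
    push_cast
    ring
  have hBn : ∀ θ ∈ Set.Icc (0:ℝ) (Real.pi/2), ‖B θ‖ ≤ K / σ^3 := by
    intro θ hθ
    have : 0 ≤ y θ := mul_nonneg (by positivity) (hsin θ hθ)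
    simp only [B, norm_mul, norm_pow, norm_inv, Complex.norm_real, Real.norm_eq_abs, abs_of_pos hσ0]
    rw [inv_pow, mul_comm, ← div_eq_mul_inv]
    gcongr
    exact hPsi _ this
  have hinv : ∀ θ ∈ Set.Icc (0:ℝ) (Real.pi/2), (Real.cos (θ/2))⁻¹ ≤ 3/2 ∧ 0 < (Real.cos (θ/2))⁻¹ := by
    intro θ hθ
    have h := hcos θ hθ
    refine ⟨?_, by apply inv_pos.2; linarith⟩
    rw [inv_le_comm₀ (by linarith) (by norm_num)]
    linarith
  have hrn : ∀ θ ∈ Set.Icc (0:ℝ) (Real.pi/2), |r θ| ≤ 6 := by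
    intro θ hθ
    obtain ⟨h1, h0⟩ := hinv θ hθ
    have h3 : (Real.cos (θ/2))⁻¹^3 ≤ (3/2)^3 := by gcongr
    have h30 : 0 < (Real.cos (θ/2))⁻¹^3 := by positivity
    simp only [r]
    rw [abs_mul, abs_of_pos hw0]
    have : |-(Real.cos (θ/2))⁻¹ - (Real.cos (θ/2))⁻¹^3/2| ≤ 4 := by
      rw [abs_le]; constructor <;> linarith
    nlinarith [abs_nonneg (-(Real.cos (θ/2))⁻¹ - (Real.cos (θ/2))⁻¹^3/2)]
  have hrn' : ∀ θ ∈ Set.Icc (0:ℝ) (Real.pi/2), |r' θ| ≤ 12 := by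
    intro θ hθ
    obtain ⟨h1, h0⟩ := hinv θ hθ
    have h2 : (Real.cos (θ/2))⁻¹^2 ≤ (3/2)^2 := by gcongr
    have h20 : 0 < (Real.cos (θ/2))⁻¹^2 := by positivity
    have h4 : (Real.cos (θ/2))⁻¹^4 ≤ (3/2)^4 := by gcongr
    have h40 : 0 < (Real.cos (θ/2))⁻¹^4 := by positivity
    have hs := hsin θ hθ
    have hs1 := Real.sin_le_one (θ/2)
    have heq : r' θ = -(w * Real.sin (θ/2) * ((Real.cos (θ/2))⁻¹^2/2 + 3/4 * (Real.cos (θ/2))⁻¹^4)) := by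
      have hc : Real.cos (θ/2) ≠ 0 := by linarith [hcos θ hθ]
      simp only [r']; field_simp; ring
    rw [heq, abs_neg, abs_mul, abs_mul, abs_of_pos hw0, abs_of_nonneg hs, abs_of_pos (by positivity)]
    calc w * Real.sin (θ/2) * ((Real.cos (θ/2))⁻¹^2/2 + 3/4 * (Real.cos (θ/2))⁻¹^4)
        ≤ 3/2 * 1 * ((3/2)^2/2 + 3/4 * (3/2)^4) := by gcongr
      _ ≤ 12 := by norm_num
  -- the primitive
  have dF : ∀ θ ∈ Set.Icc (0:ℝ) (Real.pi/2),
      HasDerivAt (fun θ => A θ * (q θ : ℂ) - B θ * (r θ : ℂ))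
        (cexp (-I * (y θ:ℂ)^2) * (Real.cos θ : ℂ) - B θ * (r' θ : ℂ)) θ := by
    intro θ hθ
    have hc : Real.cos (θ/2) ≠ 0 := by linarith [hcos θ hθ]
    refine (((dA θ).mul (dq θ hθ).ofReal_comp).sub ((dB θ).mul (dr θ hθ).ofReal_comp)).congr_deriv ?_
    have hcθ : Real.cos θ = 2 * Real.cos (θ/2)^2 - 1 := by
      rw [← Real.cos_two_mul]; congr 1; ring
    simp only [A, q, r, Complex.real_smul, hcθ]
    generalize hE : cexp (-I * (y θ:ℂ)^2) = E
    generalize B θ = Bt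
    generalize G (y θ) = g
    simp only [y]
    generalize r' θ = rt
    have hcc : (Real.cos (θ/2) : ℂ) ≠ 0 := by exact_mod_cast hc
    have hwc : (w:ℂ)^2 = 2 := by exact_mod_cast hw2
    push_cast at hcc ⊢
    generalize Complex.cos (θ/2) = c at *
    generalize Complex.sin (θ/2) = s at *
    have hw3 : (w:ℂ)^3 = 2 * w := by rw [pow_succ, hwc]
    field_simp
    ring_nf
    simp only [hwc, hw3]
    ring
  have hyc : Continuous y := continuous_iff_continuousAt.2 fun θ => (dy θ).continuousAt
  have hBc : Continuous B := continuous_iff_continuousAt.2 fun θ => (dB θ).continuousAt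
  have hu : Set.uIcc (0:ℝ) (Real.pi/2) = Set.Icc 0 (Real.pi/2) := Set.uIcc_of_le (by linarith)
  have hr'c : ContinuousOn r' (Set.Icc 0 (Real.pi/2)) := by
    have hc : ∀ θ ∈ Set.Icc (0:ℝ) (Real.pi/2), Real.cos (θ/2) ≠ 0 := fun θ hθ => by linarith [hcos θ hθ]
    refine continuousOn_const.mul (ContinuousOn.sub ?_ ?_)
    · exact ContinuousOn.div (by fun_prop) (by fun_prop) fun θ hθ => by have := hc θ hθ; positivity
    · exact ContinuousOn.div (by fun_prop) (by fun_prop) fun θ hθ => by have := hc θ hθ; positivity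
  have i1 : IntervalIntegrable (fun θ => cexp (-I * (y θ:ℂ)^2) * (Real.cos θ : ℂ)) volume 0 (Real.pi/2) := by
    apply Continuous.intervalIntegrable; fun_prop
  have i2 : IntervalIntegrable (fun θ => B θ * (r' θ : ℂ)) volume 0 (Real.pi/2) := by
    apply ContinuousOn.intervalIntegrable
    rw [hu]
    exact hBc.continuousOn.mul (Complex.continuous_ofReal.comp_continuousOn hr'c)
  have ftc := intervalIntegral.integral_eq_sub_of_hasDerivAt (fun θ hθ => dF θ (hu ▸ hθ)) (i1.sub i2)
  rw [intervalIntegral.integral_sub i1 i2] at ftc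
  have hI : (∫ θ in (0:ℝ)..(Real.pi/2), cexp (I * (t * Real.cos θ)) * (Real.cos θ : ℂ))
      = cexp (I * t) * ∫ θ in (0:ℝ)..(Real.pi/2), cexp (-I * (y θ:ℂ)^2) * (Real.cos θ : ℂ) := by
    rw [← intervalIntegral.integral_const_mul]
    congr 1
    ext θ
    rw [← mul_assoc (cexp (I * t)), ← Complex.exp_add]
    congr 2
    have hcθ : t * Real.cos θ = t - (y θ)^2 := by
      have h1 : Real.cos θ = 1 - 2 * Real.sin (θ/2)^2 := by
        have h := Real.cos_two_mul (θ/2)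
        rw [show 2 * (θ/2) = θ by ring] at h
        nlinarith [Real.sin_sq_add_cos_sq (θ/2)]
      simp only [y]
      rw [mul_pow, mul_pow, hσ2, hw2, h1]; ring
    rw [← Complex.ofReal_mul, hcθ]; push_cast; ring
  have hq1 : q (Real.pi/2) = 0 := by
    simp only [q]
    rw [show Real.pi/2/2 = Real.pi/4 by ring, Real.cos_pi_div_four, ← hw]
    field_simp
    nlinarith
  have hq0 : q 0 = w := by simp only [q]; norm_num
  have hA0 : A 0 = -((σ:ℂ)⁻¹ * cc) := by simp [A, y, G]
  have hb0 : (0:ℝ) ∈ Set.Icc (0:ℝ) (Real.pi/2) := ⟨le_rfl, by linarith⟩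
  have hb1 : Real.pi/2 ∈ Set.Icc (0:ℝ) (Real.pi/2) := ⟨by linarith, le_rfl⟩
  have hBr : ∀ θ ∈ Set.Icc (0:ℝ) (Real.pi/2), ‖B θ * (r θ : ℂ)‖ ≤ K / σ^3 * 6 := by
    intro θ hθ
    rw [norm_mul, Complex.norm_real, Real.norm_eq_abs]
    exact mul_le_mul (hBn θ hθ) (hrn θ hθ) (abs_nonneg _) (by positivity)
  have hBi : ‖∫ θ in (0:ℝ)..(Real.pi/2), B θ * (r' θ : ℂ)‖ ≤ K / σ^3 * 12 * |Real.pi/2 - 0| := by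
    apply intervalIntegral.norm_integral_le_of_norm_le_const
    intro θ hθ
    have hθ' : θ ∈ Set.Icc (0:ℝ) (Real.pi/2) := by
      rw [← hu]; exact Set.uIoc_subset_uIcc hθ
    rw [norm_mul, Complex.norm_real, Real.norm_eq_abs]
    exact mul_le_mul (hBn θ hθ') (hrn' θ hθ') (abs_nonneg _) (by positivity)
  have hfin : (∫ θ in (0:ℝ)..(Real.pi/2), cexp (-I * (y θ:ℂ)^2) * (Real.cos θ : ℂ)) - ((w / σ : ℝ) * cc)
      = (B 0 * (r 0 : ℂ) - B (Real.pi/2) * (r (Real.pi/2) : ℂ)) + ∫ θ in (0:ℝ)..(Real.pi/2), B θ * (r' θ : ℂ) := by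
    rw [sub_eq_iff_eq_add] at ftc
    rw [ftc, hq1, hq0, hA0]
    push_cast
    ring
  have hn1 : ‖cexp (I * t)‖ = 1 := by
    rw [mul_comm]; exact Complex.norm_exp_ofReal_mul_I _
  rw [hI, ← mul_sub, norm_mul, hn1, one_mul, hfin]
  have hM : 0 < K / σ^3 := by positivity
  have hpi4 := Real.pi_le_four
  rw [sub_zero, abs_of_pos (by linarith)] at hBi
  have n1 := norm_add_le (B 0 * (r 0 : ℂ) - B (Real.pi/2) * (r (Real.pi/2) : ℂ)) (∫ θ in (0:ℝ)..(Real.pi/2), B θ * (r' θ : ℂ))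
  have n2 := norm_sub_le (B 0 * (r 0 : ℂ)) (B (Real.pi/2) * (r (Real.pi/2) : ℂ))
  have n3 := hBr 0 hb0
  have n4 := hBr _ hb1
  rw [mul_div_assoc]
  nlinarith

end BJ

/-- Asymptotics of `J₁`: there is `C > 0` such that for all `t ≥ 1`,
`|J₁(t) − (sin t − cos t)/√(π t)| ≤ C t^{−3/2}`. -/
theorem besselJ_one_asymptotic :
    ∃ C > (0:ℝ), ∀ t : ℝ, 1 ≤ t →
      ‖besselJ 1 t - (((Real.sin t - Real.cos t) / Real.sqrt (Real.pi * t) : ℝ) : ℂ)‖ ≤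
        C * t ^ (-(3:ℝ)/2) := by
  obtain ⟨K, hK, hPsi⟩ := BJ.Psi_bound
  refine ⟨100 * K, by positivity, fun t ht => ?_⟩
  have hm := BJ.main_int K hK hPsi t ht
  have ht0 : 0 < t := by linarith
  have hσ : 0 < Real.sqrt t := Real.sqrt_pos.2 ht0
  have hpow : t ^ (-(3:ℝ)/2) = 1 / (Real.sqrt t)^3 := by
    rw [Real.sqrt_eq_rpow, ← Real.rpow_natCast, ← Real.rpow_mul ht0.le, one_div, ← Real.rpow_neg ht0.le]
    congr 1; norm_num
  rw [BJ.bessel_eq, ← Complex.ofReal_sub, Complex.norm_real, Real.norm_eq_abs, hpow, mul_one_div]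
  set S := ∫ θ in (0:ℝ)..(Real.pi/2), cexp (I * (t * Real.cos θ)) * (Real.cos θ : ℂ) with hS
  have him : (cexp (I * t) * ((Real.sqrt 2 / Real.sqrt t : ℝ) * BJ.cc)).im
      = Real.sqrt Real.pi / (2 * Real.sqrt t) * (Real.sin t - Real.cos t) := by
    rw [BJ.cc_eq]
    have hw : (Real.sqrt 2 : ℂ) ≠ 0 := by simp
    have hw' : (Real.sqrt t : ℂ) ≠ 0 := by exact_mod_cast hσ.ne'
    have : cexp (I * t) * ((Real.sqrt 2 / Real.sqrt t : ℝ) * ((Real.sqrt Real.pi / 2 : ℝ) * ((1 - I) / (Real.sqrt 2 : ℝ))))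
       = ((Real.sqrt Real.pi / (2 * Real.sqrt t) : ℝ) : ℂ) * (cexp (t * I) * (1 - I)) := by
      rw [mul_comm I]; push_cast; field_simp
    rw [this, Complex.im_ofReal_mul, Complex.mul_im, Complex.exp_ofReal_mul_I_re, Complex.exp_ofReal_mul_I_im]
    simp
    left
    ring
  have hmain : (Real.sin t - Real.cos t) / Real.sqrt (Real.pi * t)
      = 2 / Real.pi * (cexp (I * t) * ((Real.sqrt 2 / Real.sqrt t : ℝ) * BJ.cc)).im := by
    rw [him, Real.sqrt_mul Real.pi_pos.le]
    have hp : 0 < Real.sqrt Real.pi := Real.sqrt_pos.2 Real.pi_pos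
    have hp2 : Real.sqrt Real.pi ^ 2 = Real.pi := Real.sq_sqrt Real.pi_pos.le
    have hpi := Real.pi_pos
    field_simp
    rw [hp2]
  rw [hmain, ← mul_sub, ← Complex.sub_im, abs_mul]
  have h1 : |2 / Real.pi| ≤ 1 := by
    rw [abs_of_pos (by have := Real.pi_pos; positivity), div_le_one Real.pi_pos]
    exact Real.two_le_pi
  calc _ ≤ 1 * ‖S - cexp (I * t) * ((Real.sqrt 2 / Real.sqrt t : ℝ) * BJ.cc)‖ := by
        gcongr
        exact Complex.abs_im_le_norm _
    _ ≤ _ := by rw [one_mul]; exact hm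
end

section
/- Let k > 0 and let D ⊂ ℝ² be a bounded measurable set. Then the squared H⁴(D)-norm of x ↦ J₀(k|x − z|) decays like the reciprocal distance: there exist constants C > 0 and R > 0 such that for every z ∈ ℝ² with dist(z, D) ≥ R, Σ_{s + t ≤ 4} ∫_D |∂_{x₁}^{s} ∂_{x₂}^{t} J₀(k |x − z|)|² dx ≤ C / dist(z, D), where the sum is over all pairs of nonnegative integers (s, t) with s + t ≤ 4 and the derivatives are taken on the open set ℝ² \ {z}. -/
open Complex Real MeasureTheory
open scoped RealInnerProductSpace InnerProductSpace

/-- The unit direction vector `d(φ) = (cos φ, sin φ)` in the Euclidean plane. -/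
noncomputable def dir (φ : ℝ) : EuclideanSpace ℝ (Fin 2) :=
  (WithLp.equiv 2 (Fin 2 → ℝ)).symm ![Real.cos φ, Real.sin φ]

/-- First-order partial derivative in the `i`-th coordinate direction. -/
noncomputable def pd (i : Fin 2) (f : EuclideanSpace ℝ (Fin 2) → ℂ) :
    EuclideanSpace ℝ (Fin 2) → ℂ :=
  fun x => fderiv ℝ f x (EuclideanSpace.single i 1)

lemma aux_int_inv (l : ℝ) (hl : 0 < l) :
    ∫ φ in (-Real.pi)..Real.pi, (1 + l * Real.sin φ ^ 2)⁻¹ ≤ Real.pi ^ 2 / Real.sqrt l := by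
  have hsl : 0 < Real.sqrt l := Real.sqrt_pos.2 hl
  have hpi := Real.pi_pos
  have hw : ∀ φ : ℝ, 0 < 1 + l * Real.sin φ ^ 2 := fun φ => by positivity
  have hcont : Continuous (fun φ : ℝ => (1 + l * Real.sin φ ^ 2)⁻¹) :=
    Continuous.inv₀ (by fun_prop) (fun φ => (hw φ).ne')
  have hper : Function.Periodic (fun φ : ℝ => (1 + l * Real.sin φ ^ 2)⁻¹) Real.pi := by
    intro φ
    simp [Real.sin_add_pi]
  have h1 : ∫ φ in (-Real.pi)..Real.pi, (1 + l * Real.sin φ ^ 2)⁻¹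
      = 2 * ∫ φ in (-(Real.pi/2))..(Real.pi/2), (1 + l * Real.sin φ ^ 2)⁻¹ := by
    rw [← intervalIntegral.integral_add_adjacent_intervals (b := 0)
      (hcont.intervalIntegrable _ _) (hcont.intervalIntegrable _ _)]
    have e1 := hper.intervalIntegral_add_eq (-Real.pi) (-(Real.pi/2))
    have e2 := hper.intervalIntegral_add_eq 0 (-(Real.pi/2))
    rw [show -Real.pi + Real.pi = 0 by ring, show -(Real.pi/2) + Real.pi = Real.pi/2 by ring] at e1
    rw [show 0 + Real.pi = Real.pi by ring, show -(Real.pi/2) + Real.pi = Real.pi/2 by ring] at e2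
    rw [e1, e2]; ring
  set c : ℝ := 2 / Real.pi * Real.sqrt l with hc
  have hc0 : 0 < c := by positivity
  have hcont2 : Continuous (fun φ : ℝ => (1 + (c * φ) ^ 2)⁻¹) :=
    Continuous.inv₀ (by fun_prop) (fun φ => by positivity)
  have h2 : ∫ φ in (-(Real.pi/2))..(Real.pi/2), (1 + l * Real.sin φ ^ 2)⁻¹
      ≤ ∫ φ in (-(Real.pi/2))..(Real.pi/2), (1 + (c * φ) ^ 2)⁻¹ := by
    apply intervalIntegral.integral_mono_on (by linarith) (hcont.intervalIntegrable _ _)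
      (hcont2.intervalIntegrable _ _)
    intro x hx
    have hx' : |x| ≤ Real.pi / 2 := abs_le.2 hx
    have hj := Real.mul_abs_le_abs_sin hx'
    have hsq : (2 / Real.pi * |x|) ^ 2 ≤ |Real.sin x| ^ 2 := by
      gcongr
    rw [sq_abs, mul_pow, sq_abs] at hsq
    apply inv_anti₀ (by positivity)
    have : (c * x) ^ 2 = l * ((2 / Real.pi) ^ 2 * x ^ 2) := by
      rw [hc, mul_pow, mul_pow, Real.sq_sqrt hl.le]; ring
    rw [this]
    gcongr
  have h3 : ∫ φ in (-(Real.pi/2))..(Real.pi/2), (1 + (c * φ) ^ 2)⁻¹ ≤ c⁻¹ * Real.pi := by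
    rw [intervalIntegral.integral_comp_mul_left (fun x => (1 + x ^ 2)⁻¹) hc0.ne']
    rw [integral_inv_one_add_sq, smul_eq_mul]
    have a1 := Real.arctan_lt_pi_div_two (c * (Real.pi/2))
    have a2 := Real.neg_pi_div_two_lt_arctan (c * -(Real.pi/2))
    gcongr
    linarith
  rw [h1]
  calc _ ≤ 2 * (c⁻¹ * Real.pi) := by gcongr; exact h2.trans h3
    _ = _ := by rw [hc]; field_simp

lemma aux_vdc (l M : ℝ) (hl : 0 < l) (b b' : ℝ → ℂ)
    (hb : ∀ x, HasDerivAt b (b' x) x) (hb'c : Continuous b')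
    (hb1 : ∀ x, ‖b x‖ ≤ 1) (hb2 : ∀ x, ‖b' x‖ ≤ M) :
    ‖∫ φ in (-Real.pi)..Real.pi, b φ * Complex.exp (Complex.I * ((l * Real.cos φ : ℝ) : ℂ))‖
      ≤ (2 * Real.pi * M + 2 * Real.pi ^ 2) / Real.sqrt l := by
  have hsl : 0 < Real.sqrt l := Real.sqrt_pos.2 hl
  have hpi := Real.pi_pos
  have hM : 0 ≤ M := (norm_nonneg _).trans (hb2 0)
  have hw : ∀ φ : ℝ, 0 < 1 + l * Real.sin φ ^ 2 := fun φ => by positivity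
  have hbc : Continuous b := continuous_iff_continuousAt.2 fun x => (hb x).continuousAt
  have hcont : Continuous (fun φ : ℝ => (1 + l * Real.sin φ ^ 2)⁻¹) :=
    Continuous.inv₀ (by fun_prop) (fun φ => (hw φ).ne')
  let g : ℝ → ℝ := fun φ => Real.sin φ * (1 + l * Real.sin φ ^ 2)⁻¹
  let g' : ℝ → ℝ := fun φ => Real.cos φ * (1 - l * Real.sin φ ^ 2) * ((1 + l * Real.sin φ ^ 2)⁻¹) ^ 2
  have hg : ∀ x, HasDerivAt g (g' x) x := by
    intro x
    have h1 : HasDerivAt (fun φ : ℝ => 1 + l * Real.sin φ ^ 2)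
        (l * (2 * Real.sin x * Real.cos x)) x := by
      have := (((Real.hasDerivAt_sin x).pow 2).const_mul l).const_add 1
      exact this.congr_deriv (by simp)
    have h2 := (Real.hasDerivAt_sin x).mul (h1.inv (hw x).ne')
    refine h2.congr_deriv ?_
    simp only [g', Pi.inv_apply]
    have := (hw x).ne'
    field_simp
    ring
  let v : ℝ → ℂ := fun φ => Complex.exp (Complex.I * ((l * Real.cos φ : ℝ) : ℂ))
  let v' : ℝ → ℂ := fun φ => v φ * (Complex.I * ((l * (-Real.sin φ) : ℝ) : ℂ))
  have hv : ∀ x, HasDerivAt v (v' x) x := by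
    intro x
    exact ((((Real.hasDerivAt_cos x).const_mul l).ofReal_comp).const_mul Complex.I).cexp
  have hvn : ∀ x, ‖v x‖ = 1 := fun x => by
    simp only [v]; rw [mul_comm]; exact Complex.norm_exp_ofReal_mul_I _
  have hvc : Continuous v := by fun_prop
  have hgc : Continuous g := by fun_prop
  have hg'c : Continuous g' := by fun_prop
  let T : ℝ → ℂ := fun x => (b' x * (g x : ℂ) + b x * (g' x : ℂ)) * v x + b x * (g x : ℂ) * v' x
  have hT : ∀ x, HasDerivAt (fun y => b y * (g y : ℂ) * v y) (T x) x := fun x =>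
    (((hb x).mul (hg x).ofReal_comp).mul (hv x))
  have hTc : Continuous T := by fun_prop
  have hT0 : ∫ φ in (-Real.pi)..Real.pi, T φ = 0 := by
    rw [intervalIntegral.integral_eq_sub_of_hasDerivAt (fun x _ => hT x)
      (hTc.intervalIntegrable _ _)]
    simp [g]
  have hI : ∫ φ in (-Real.pi)..Real.pi, b φ * v φ
      = ∫ φ in (-Real.pi)..Real.pi, (b φ * v φ - Complex.I * T φ) := by
    rw [intervalIntegral.integral_sub ((by fun_prop : Continuous fun φ => b φ * v φ).intervalIntegrable _ _)
      ((by fun_prop : Continuous fun φ => Complex.I * T φ).intervalIntegrable _ _), intervalIntegral.integral_const_mul, hT0]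
    simp
  have hpt : ∀ x, ‖b x * v x - Complex.I * T x‖
      ≤ M / Real.sqrt l + 2 * (1 + l * Real.sin x ^ 2)⁻¹ := by
    intro x
    have e : b x * v x - Complex.I * T x =
        (b x * (((1 + l * Real.sin x ^ 2)⁻¹ : ℝ) : ℂ)
          - Complex.I * (b' x * (g x : ℂ) + b x * (g' x : ℂ))) * v x := by
      have e1 : b x * v x * (1 - (((1 + l * Real.sin x ^ 2)⁻¹ : ℝ) : ℂ)
          - ((g x * (l * Real.sin x) : ℝ) : ℂ)) = 0 := by
        have : (1 : ℝ) - (1 + l * Real.sin x ^ 2)⁻¹ - g x * (l * Real.sin x) = 0 := by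
          have := (hw x).ne'
          simp only [g]
          field_simp
          ring
        have h2 := congrArg (fun r : ℝ => (r : ℂ)) this
        rw [Complex.ofReal_sub, Complex.ofReal_sub] at h2
        simp only [Complex.ofReal_one, Complex.ofReal_zero] at h2
        rw [h2, mul_zero]
      simp only [T, v']
      generalize v x = V at *
      generalize ((1 + l * Real.sin x ^ 2)⁻¹ : ℝ) = W at *
      push_cast at e1 ⊢
      linear_combination e1 + b x * (g x) * V * l * Complex.sin x * Complex.I_sq
    rw [e, norm_mul, hvn, mul_one]
    have hg1 : |g x| ≤ 1 / Real.sqrt l := by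
      simp only [g]
      rw [abs_mul, abs_of_pos (inv_pos.2 (hw x)), ← div_eq_mul_inv,
        div_le_div_iff₀ (hw x) hsl]
      have h3 : l * Real.sin x ^ 2 = (|Real.sin x| * Real.sqrt l) ^ 2 := by
        rw [mul_pow, sq_abs, Real.sq_sqrt hl.le]; ring
      rw [h3]
      nlinarith [sq_nonneg (|Real.sin x| * Real.sqrt l - 1), abs_nonneg (Real.sin x)]
    have hg2 : |g' x| ≤ (1 + l * Real.sin x ^ 2)⁻¹ := by
      simp only [g']
      have hW := inv_pos.2 (hw x)
      have h5 : |1 - l * Real.sin x ^ 2| ≤ 1 + l * Real.sin x ^ 2 := by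
        have : 0 ≤ l * Real.sin x ^ 2 := by positivity
        rw [abs_le]; constructor <;> linarith
      rw [abs_mul, abs_mul, abs_of_pos (pow_pos hW 2)]
      calc _ ≤ 1 * (1 + l * Real.sin x ^ 2) * ((1 + l * Real.sin x ^ 2)⁻¹) ^ 2 := by
            gcongr
            exact Real.abs_cos_le_one x
        _ = _ := by
            have := (hw x).ne'
            field_simp
    calc _ ≤ ‖b x * (((1 + l * Real.sin x ^ 2)⁻¹ : ℝ) : ℂ)‖
          + ‖Complex.I * (b' x * (g x : ℂ) + b x * (g' x : ℂ))‖ := norm_sub_le _ _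
      _ ≤ 1 * (1 + l * Real.sin x ^ 2)⁻¹ + (M * (1 / Real.sqrt l) + 1 * (1 + l * Real.sin x ^ 2)⁻¹) := by
          apply add_le_add
          · rw [norm_mul, Complex.norm_real, Real.norm_of_nonneg (inv_pos.2 (hw x)).le]
            exact mul_le_mul_of_nonneg_right (hb1 x) (inv_pos.2 (hw x)).le
          · rw [norm_mul, Complex.norm_I, one_mul]
            refine (norm_add_le _ _).trans (add_le_add ?_ ?_)
            · rw [norm_mul, Complex.norm_real, Real.norm_eq_abs]
              exact mul_le_mul (hb2 x) hg1 (abs_nonneg _) hM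
            · rw [norm_mul, Complex.norm_real, Real.norm_eq_abs]
              exact mul_le_mul (hb1 x) hg2 (abs_nonneg _) zero_le_one
      _ = _ := by ring
  change ‖∫ φ in (-Real.pi)..Real.pi, b φ * v φ‖ ≤ _
  rw [hI]
  calc _ ≤ ∫ x in (-Real.pi)..Real.pi, (M / Real.sqrt l + 2 * (1 + l * Real.sin x ^ 2)⁻¹) :=
        intervalIntegral.norm_integral_le_of_norm_le (by linarith)
          (Filter.Eventually.of_forall fun x _ => hpt x)
          ((by fun_prop : Continuous _).intervalIntegrable _ _)
    _ = 2 * Real.pi * (M / Real.sqrt l) +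
          2 * ∫ x in (-Real.pi)..Real.pi, (1 + l * Real.sin x ^ 2)⁻¹ := by
        rw [intervalIntegral.integral_add (continuous_const.intervalIntegrable _ _)
          ((by fun_prop : Continuous fun x => 2 * (1 + l * Real.sin x ^ 2)⁻¹).intervalIntegrable _ _),
          intervalIntegral.integral_const_mul]
        simp; ring
    _ ≤ 2 * Real.pi * (M / Real.sqrt l) + 2 * (Real.pi ^ 2 / Real.sqrt l) := by
        gcongr
        exact aux_int_inv l hl
    _ = _ := by ring

lemma aux_shift {E : Type*} [NormedAddCommGroup E] [NormedSpace ℝ E] (f : ℝ → E)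
    (hf : Function.Periodic f (2 * Real.pi)) (c : ℝ) :
    ∫ φ in (-Real.pi)..Real.pi, f (φ + c) = ∫ φ in (-Real.pi)..Real.pi, f φ := by
  rw [intervalIntegral.integral_comp_add_right]
  have := hf.intervalIntegral_add_eq (-Real.pi + c) (-Real.pi)
  rw [show -Real.pi + c + 2 * Real.pi = Real.pi + c by ring,
    show -Real.pi + 2 * Real.pi = Real.pi by ring] at this
  exact this

/-- phase -/
noncomputable def phs (w : EuclideanSpace ℝ (Fin 2)) (φ : ℝ) : ℝ :=
  w 0 * Real.cos φ + w 1 * Real.sin φ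

noncomputable def GG (k : ℝ) (z : EuclideanSpace ℝ (Fin 2)) (a : ℝ → ℂ)
    (x : EuclideanSpace ℝ (Fin 2)) : ℂ :=
  ∫ φ in (-Real.pi)..Real.pi, a φ * Complex.exp (Complex.I * ((k * phs (x - z) φ : ℝ) : ℂ))

lemma aux_polar (w : EuclideanSpace ℝ (Fin 2)) :
    ∃ θ : ℝ, ∀ φ, phs w φ = ‖w‖ * Real.cos (φ - θ) := by
  let c : ℂ := ⟨w 0, w 1⟩
  have hn : ‖w‖ = ‖c‖ := by
    rw [EuclideanSpace.norm_eq, Complex.norm_eq_sqrt_sq_add_sq]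
    simp [c]
  refine ⟨Complex.arg c, fun φ => ?_⟩
  have h0 : ‖c‖ * Real.cos (Complex.arg c) = w 0 := Complex.norm_mul_cos_arg c
  have h1 : ‖c‖ * Real.sin (Complex.arg c) = w 1 := Complex.norm_mul_sin_arg c
  rw [phs, hn, Real.cos_sub, ← h0, ← h1]; ring

lemma aux_bessel (k : ℝ) (z x : EuclideanSpace ℝ (Fin 2)) :
    besselJ 0 (k * ‖x - z‖) = GG k z (fun _ => (1 / (2 * Real.pi) : ℂ)) x := by
  obtain ⟨θ, hθ⟩ := aux_polar (x - z)
  rw [GG, intervalIntegral.integral_const_mul, besselJ]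
  congr 1
  rw [← aux_shift (fun φ => Complex.exp (Complex.I * ((k * phs (x - z) φ : ℝ) : ℂ)))
    (fun φ => by simp [phs]) (θ - Real.pi / 2)]
  apply intervalIntegral.integral_congr
  intro φ _
  simp only [hθ]
  rw [show φ + (θ - Real.pi / 2) - θ = φ - Real.pi / 2 by ring, Real.cos_sub_pi_div_two]
  push_cast
  congr 2
  ring

/-- bounded linear form `x ↦ x · d(φ)` -/
noncomputable def phL (φ : ℝ) : EuclideanSpace ℝ (Fin 2) →L[ℝ] ℝ :=
  Real.cos φ • EuclideanSpace.proj (0 : Fin 2) + Real.sin φ • EuclideanSpace.proj (1 : Fin 2)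

lemma phL_apply (φ : ℝ) (x : EuclideanSpace ℝ (Fin 2)) : phL φ x = phs x φ := by
  simp [phL, phs]; ring

lemma phL_norm (φ : ℝ) : ‖phL φ‖ ≤ 1 := by
  refine ContinuousLinearMap.opNorm_le_bound _ zero_le_one fun x => ?_
  obtain ⟨θ, hθ⟩ := aux_polar x
  rw [phL_apply, hθ, norm_mul, norm_norm, one_mul]
  exact mul_le_of_le_one_right (norm_nonneg _) (Real.abs_cos_le_one _)

lemma phL_cont : Continuous phL := by
  unfold phL; fun_prop

lemma aux_hasFDeriv (k : ℝ) (z : EuclideanSpace ℝ (Fin 2)) (a : ℝ → ℂ) (ha : Continuous a)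
    (x : EuclideanSpace ℝ (Fin 2)) (i : Fin 2) :
    pd i (GG k z a) x = GG k z (fun φ => Complex.I * k * phs (EuclideanSpace.single i 1) φ * a φ) x := by
  let F : EuclideanSpace ℝ (Fin 2) → ℝ → ℂ := fun y φ =>
    a φ * Complex.exp (Complex.I * ((k * phs (y - z) φ : ℝ) : ℂ))
  let F' : EuclideanSpace ℝ (Fin 2) → ℝ → (EuclideanSpace ℝ (Fin 2) →L[ℝ] ℂ) := fun y φ =>
    (F y φ * (Complex.I * k)) • (Complex.ofRealCLM.comp (phL φ))
  have hFc : ∀ y, Continuous (F y) := fun y => by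
    simp only [F, phs]; fun_prop
  have hF'c : ∀ y, Continuous (F' y) := fun y => by
    have := hFc y
    have := phL_cont
    simp only [F']
    fun_prop
  have hd : ∀ y φ, HasFDerivAt (fun y => F y φ) (F' y φ) y := by
    intro y φ
    have h1 : HasFDerivAt (fun y => phL φ (y - z)) (phL φ) y := by
      have := (phL φ).hasFDerivAt.comp y ((hasFDerivAt_id y).sub_const z)
      exact this
    have h2 : HasFDerivAt (fun y => ((k * phs (y - z) φ : ℝ) : ℂ))
        ((k : ℂ) • (Complex.ofRealCLM.comp (phL φ))) y := by
      have := (Complex.ofRealCLM.hasFDerivAt.comp y h1).const_mul (k : ℂ)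
      refine this.congr_of_eventuallyEq (Filter.Eventually.of_forall fun y => ?_)
      simp [phL_apply]
    have h3 := ((h2.const_mul Complex.I).cexp).const_mul (a φ)
    refine h3.congr_fderiv ?_
    simp only [F', F, smul_smul]
    congr 1
    ring
  have hFn : ∀ y φ, ‖F y φ‖ = ‖a φ‖ := fun y φ => by
    simp only [F]
    rw [norm_mul, mul_comm Complex.I, Complex.norm_exp_ofReal_mul_I, mul_one]
  have key := intervalIntegral.hasFDerivAt_integral_of_dominated_of_fderiv_le
    (μ := volume) (F := F) (F' := F') (x₀ := x) (a := -Real.pi) (b := Real.pi)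
    (bound := fun φ => ‖a φ‖ * |k|) (s := Set.univ) Filter.univ_mem
    (Filter.Eventually.of_forall fun y => (hFc y).aestronglyMeasurable)
    ((hFc x).intervalIntegrable _ _)
    (hF'c x).aestronglyMeasurable
    (Filter.Eventually.of_forall fun φ _ y _ => by
      simp only [F']
      rw [norm_smul, norm_mul, hFn, norm_mul, Complex.norm_I, Complex.norm_real, one_mul,
        Real.norm_eq_abs]
      refine mul_le_of_le_one_right (by positivity) ?_
      refine (ContinuousLinearMap.opNorm_comp_le _ _).trans ?_
      rw [Complex.ofRealCLM_norm, one_mul]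
      exact phL_norm φ)
    ((by fun_prop : Continuous _).intervalIntegrable _ _)
    (Filter.Eventually.of_forall fun φ _ y _ => hd y φ)
  have hfd : fderiv ℝ (GG k z a) x = ∫ φ in (-Real.pi)..Real.pi, F' x φ := key.fderiv
  rw [pd, hfd, ContinuousLinearMap.intervalIntegral_apply ((hF'c x).intervalIntegrable _ _), GG]
  apply intervalIntegral.integral_congr
  intro φ _
  simp only [F', F]
  simp [phL_apply]
  ring

lemma aux_iter (k : ℝ) (z : EuclideanSpace ℝ (Fin 2)) (s t : ℕ) :
    (pd 0)^[s] ((pd 1)^[t] (fun y => besselJ 0 (k * ‖y - z‖))) =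
      GG k z (fun φ => ((Complex.I * k) ^ (s + t) / (2 * Real.pi)) *
        ((Real.cos φ ^ s * Real.sin φ ^ t : ℝ) : ℂ)) := by
  have h1 : ∀ t : ℕ, (pd 1)^[t] (fun y => besselJ 0 (k * ‖y - z‖)) =
      GG k z (fun φ => ((Complex.I * k) ^ t / (2 * Real.pi)) * ((Real.sin φ ^ t : ℝ) : ℂ)) := by
    intro t
    induction t with
    | zero =>
      funext y
      simp only [Function.iterate_zero, id]
      rw [aux_bessel]
      simp
    | succ n ih =>
      rw [Function.iterate_succ_apply', ih]
      funext y
      rw [aux_hasFDeriv _ _ _ (by fun_prop)]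
      congr 1
      funext φ
      simp [phs]
      ring
  induction s with
  | zero => simp [h1]
  | succ n ih =>
    rw [Function.iterate_succ_apply', ih]
    funext y
    rw [aux_hasFDeriv _ _ _ (by fun_prop)]
    congr 1
    funext φ
    simp [phs]
    ring

lemma aux_bound (k : ℝ) (hk : 0 < k) (s t : ℕ) (z x : EuclideanSpace ℝ (Fin 2))
    (hx : 0 < ‖x - z‖) :
    ‖(pd 0)^[s] ((pd 1)^[t] (fun y => besselJ 0 (k * ‖y - z‖))) x‖ ≤
      k ^ (s + t) / (2 * Real.pi) *
        ((2 * Real.pi * (s + t) + 2 * Real.pi ^ 2) / Real.sqrt (k * ‖x - z‖)) := by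
  have hpi := Real.pi_pos
  rw [aux_iter, GG]
  simp only [mul_assoc]
  rw [intervalIntegral.integral_const_mul, norm_mul]
  have hn : ‖(Complex.I * k) ^ (s + t) / (2 * Real.pi : ℂ)‖ = k ^ (s + t) / (2 * Real.pi) := by
    simp [abs_of_pos hk, abs_of_pos hpi]
  rw [hn]
  gcongr
  obtain ⟨θ, hθ⟩ := aux_polar (x - z)
  rw [← aux_shift _ (fun φ => by simp [phs]) θ]
  simp only [hθ, add_sub_cancel_right, ← mul_assoc]
  let c : ℝ → ℝ := fun φ => Real.cos (φ + θ) ^ s * Real.sin (φ + θ) ^ t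
  let c' : ℝ → ℝ := fun φ => (s * Real.cos (φ + θ) ^ (s - 1) * (-Real.sin (φ + θ))) * Real.sin (φ + θ) ^ t
    + Real.cos (φ + θ) ^ s * (t * Real.sin (φ + θ) ^ (t - 1) * Real.cos (φ + θ))
  have hc : ∀ φ, HasDerivAt c (c' φ) φ := by
    intro φ
    have h1 : HasDerivAt (fun φ => Real.cos (φ + θ)) (-Real.sin (φ + θ)) φ :=
      (Real.hasDerivAt_cos (φ + θ)).comp_add_const φ θ
    have h2 : HasDerivAt (fun φ => Real.sin (φ + θ)) (Real.cos (φ + θ)) φ :=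
      (Real.hasDerivAt_sin (φ + θ)).comp_add_const φ θ
    exact (h1.pow s).mul (h2.pow t)
  have hcos : ∀ (φ : ℝ) (n : ℕ), |Real.cos φ| ^ n ≤ 1 := fun φ n =>
    pow_le_one₀ (abs_nonneg _) (Real.abs_cos_le_one φ)
  have hsin : ∀ (φ : ℝ) (n : ℕ), |Real.sin φ| ^ n ≤ 1 := fun φ n =>
    pow_le_one₀ (abs_nonneg _) (Real.abs_sin_le_one φ)
  refine aux_vdc (k * ‖x - z‖) (s + t) (by positivity) (fun φ => (c φ : ℂ)) (fun φ => (c' φ : ℂ))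
    (fun φ => (hc φ).ofReal_comp) (by fun_prop) (fun φ => ?_) (fun φ => ?_)
  · rw [Complex.norm_real, Real.norm_eq_abs]
    simp only [c]
    rw [abs_mul, abs_pow, abs_pow]
    exact mul_le_one₀ (hcos _ _) (by positivity) (hsin _ _)
  · rw [Complex.norm_real, Real.norm_eq_abs]
    simp only [c']
    refine (abs_add_le _ _).trans (add_le_add ?_ ?_)
    · rw [abs_mul, abs_mul, abs_mul, abs_neg, abs_pow, abs_pow, Nat.abs_cast]
      calc _ ≤ (s : ℝ) * 1 * 1 * 1 := by
            gcongr
            · exact hcos _ _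
            · exact Real.abs_sin_le_one _
            · exact hsin _ _
        _ = _ := by ring
    · rw [abs_mul, abs_mul, abs_mul, abs_pow, abs_pow, Nat.abs_cast]
      calc _ ≤ 1 * ((t : ℝ) * 1 * 1) := by
            gcongr
            · exact hcos _ _
            · exact hsin _ _
            · exact Real.abs_cos_le_one _
        _ = _ := by ring

/-- For `k > 0` and a bounded measurable set `D ⊂ ℝ²`, the squared `H⁴(D)`-norm of
`x ↦ J₀(k|x−z|)` decays like `1/dist(z,D)`: there are `C > 0` and `R > 0` such that
for every `z` with `dist(z, D) ≥ R`,
`Σ_{s+t ≤ 4} ∫_D |∂₁^s ∂₂^t J₀(k|x−z|)|² dx ≤ C / dist(z, D)`. -/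
theorem besselJ_H4_decay (k : ℝ) (hk : 0 < k) (D : Set (EuclideanSpace ℝ (Fin 2)))
    (hDb : Bornology.IsBounded D) (hDm : MeasurableSet D) :
    ∃ C > (0:ℝ), ∃ R > (0:ℝ), ∀ z : EuclideanSpace ℝ (Fin 2),
      R ≤ Metric.infDist z D →
        (∑ p ∈ (Finset.range 5 ×ˢ Finset.range 5).filter (fun p => p.1 + p.2 ≤ 4),
            ∫ x in D,
              ‖(pd 0)^[p.1] ((pd 1)^[p.2] (fun y => besselJ 0 (k * ‖y - z‖))) x‖ ^ 2) ≤
          C / Metric.infDist z D := by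
  let K : ℕ × ℕ → ℝ := fun p => k ^ (p.1 + p.2) / (2 * Real.pi) *
        (2 * Real.pi * (p.1 + p.2) + 2 * Real.pi ^ 2)
  let S := (Finset.range 5 ×ˢ Finset.range 5).filter (fun p : ℕ × ℕ => p.1 + p.2 ≤ 4)
  have hpi := Real.pi_pos
  have hvol : volume D < ⊤ := hDb.measure_lt_top
  refine ⟨(∑ p ∈ S, K p ^ 2 / k * volume.real D) + 1, ?_, 1, one_pos, ?_⟩
  · have : 0 ≤ ∑ p ∈ S, K p ^ 2 / k * volume.real D :=
      Finset.sum_nonneg fun p _ => by positivity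
    linarith
  intro z hz
  set d := Metric.infDist z D with hd
  have hd0 : 0 < d := by linarith
  have hterm : ∀ p ∈ S, ∫ x in D,
      ‖(pd 0)^[p.1] ((pd 1)^[p.2] (fun y => besselJ 0 (k * ‖y - z‖))) x‖ ^ 2 ≤
      K p ^ 2 / k * volume.real D / d := by
    intro p _
    have hK : 0 ≤ K p := by simp only [K]; positivity
    have hb : ∀ x ∈ D, ‖‖(pd 0)^[p.1] ((pd 1)^[p.2] (fun y => besselJ 0 (k * ‖y - z‖))) x‖ ^ 2‖
        ≤ K p ^ 2 / (k * d) := by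
      intro x hx
      have hdx : d ≤ ‖x - z‖ := by
        rw [← dist_eq_norm, dist_comm]
        exact Metric.infDist_le_dist_of_mem hx
      have hx0 : 0 < ‖x - z‖ := by linarith
      have h1 := aux_bound k hk p.1 p.2 z x hx0
      rw [← mul_div_assoc] at h1
      rw [norm_pow, norm_norm]
      calc _ ≤ (K p / Real.sqrt (k * ‖x - z‖)) ^ 2 := by
            gcongr
        _ = K p ^ 2 / (k * ‖x - z‖) := by
            rw [div_pow, Real.sq_sqrt (by positivity)]
        _ ≤ _ := by gcongr
    have h2 := norm_setIntegral_le_of_norm_le_const hvol hb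
    refine (le_abs_self _).trans (h2.trans (le_of_eq ?_))
    field_simp
  refine (Finset.sum_le_sum hterm).trans ?_
  rw [← Finset.sum_div]
  gcongr
  linarith
end
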